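/- arXiv:1907.08260 — 10 statements merged into one kernel-verified Lean document; each statement's English description precedes it below -/
import Mathlib

section
/- Let f_μ and f_ν be nonnegative Lebesgue-integrable functions on ℝ with ∫ f_μ dλ = ∫ f_ν dλ = 1, and let μ = f_μ·λ and ν = f_ν·λ. If W₁, W₂ : ℝ → ℝ are two nondecreasing Borel maps with W₁♯μ = ν and W₂♯μ = ν, then W₁ = W₂ μ-almost everywhere. In particular the nondecreasing transport from μ to ν is unique up to μ-null sets. -/
open MeasureTheory Set

/-- If two monotone measurable maps push a finite measure to the same measure, then the second is
almost everywhere at most the first. -/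
theorem Monotone.ae_le_of_map_eq {α : Type*} [LinearOrder α] [MeasurableSpace α]
    {μ : Measure α} [IsFiniteMeasure μ] {f g : α → ℝ} (hf : Monotone f) (hg : Monotone g)
    (hfm : Measurable f) (hgm : Measurable g) (h : μ.map f = μ.map g) : g ≤ᵐ[μ] f := by
  have hnull (q : ℚ) : μ (f ⁻¹' Iic (q : ℝ) \ g ⁻¹' Iic (q : ℝ)) = 0 := by
    have hlf : IsLowerSet (f ⁻¹' Iic (q : ℝ)) := (isLowerSet_Iic _).preimage hf
    have hlg : IsLowerSet (g ⁻¹' Iic (q : ℝ)) := (isLowerSet_Iic _).preimage hg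
    rcases hlf.total hlg with hsub | hsub
    · rw [sdiff_eq_empty.mpr hsub, measure_empty]
    · rw [measure_sdiff hsub (hgm measurableSet_Iic).nullMeasurableSet (measure_ne_top _ _),
        ← Measure.map_apply hfm measurableSet_Iic, ← Measure.map_apply hgm measurableSet_Iic, h,
        tsub_self]
  refine measure_mono_null (fun x hx => ?_) (measure_iUnion_null hnull)
  obtain ⟨q, hfq, hqg⟩ := exists_rat_btwn (show f x < g x from not_le.mp hx)
  exact mem_iUnion.mpr ⟨q, hfq.le, hqg.not_ge⟩

/-- Uniqueness (up to `μ`-null sets) of the nondecreasing transport map pushing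
`μ = f_μ·λ` forward to `ν = f_ν·λ`. -/
theorem monotone_transport_unique
    (fμ fν : ℝ → ℝ)
    (hfμ0 : ∀ x, 0 ≤ fμ x) (hfν0 : ∀ y, 0 ≤ fν y)
    (hfμi : Integrable fμ) (hfνi : Integrable fν)
    (hfμ1 : ∫ x, fμ x = 1) (hfν1 : ∫ y, fν y = 1)
    (μ ν : Measure ℝ)
    (hμ : μ = volume.withDensity (fun x => ENNReal.ofReal (fμ x)))
    (hν : ν = volume.withDensity (fun y => ENNReal.ofReal (fν y)))
    (W₁ W₂ : ℝ → ℝ)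
    (hW₁m : Monotone W₁) (hW₂m : Monotone W₂)
    (hW₁ : Measure.map W₁ μ = ν) (hW₂ : Measure.map W₂ μ = ν) :
    W₁ =ᵐ[μ] W₂ := by
  have : IsFiniteMeasure μ := hμ ▸ isFiniteMeasure_withDensity_ofReal hfμi.2
  have h : μ.map W₁ = μ.map W₂ := hW₁.trans hW₂.symm
  exact (hW₂m.ae_le_of_map_eq hW₁m hW₂m.measurable hW₁m.measurable h.symm).antisymm
    (hW₁m.ae_le_of_map_eq hW₂m hW₁m.measurable hW₂m.measurable h)
end

section
/- Let T : ℝ → ℝ be continuously differentiable and let f_μ : ℝ → ℝ be a nonnegative Lebesgue-integrable function vanishing outside [0,1]. Assume the set of critical points { x ∈ [0,1] : T'(x) = 0 } is finite. Then the pushforward measure ν = T♯(f_μ·λ restricted to [0,1]) is absolutely continuous with respect to λ, for λ-almost every y the set T⁻¹(y) ∩ [0,1] is finite and contains no critical point, and ν has density g(y) = Σ_{x ∈ T⁻¹(y) ∩ [0,1]} f_μ(x)/|T'(x)| for λ-almost every y. -/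
open MeasureTheory Set
open scoped ENNReal

section FiberSum

variable {T : ℝ → ℝ} {S : Set ℝ} {G : ℝ → ℝ≥0∞}

theorem tsum_fiber_of_injOn (hinj : InjOn T S) {x : ℝ} (hx : x ∈ S) :
    ∑' z : ↥(T ⁻¹' {T x} ∩ S), G z = G x := by
  have h : T ⁻¹' {T x} ∩ S = {x} := by
    ext z
    exact ⟨fun hz => hinj hz.2 hx hz.1, fun hz => by rw [mem_singleton_iff.1 hz]; exact ⟨rfl, hx⟩⟩
  rw [h, tsum_singleton]

theorem tsum_fiber_of_notMem_image {y : ℝ} (hy : y ∉ T '' S) :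
    ∑' z : ↥(T ⁻¹' {y} ∩ S), G z = 0 := by
  have h : T ⁻¹' {y} ∩ S = ∅ :=
    eq_empty_of_forall_notMem fun z hz => hy ⟨z, hz.2, hz.1⟩
  rw [h, tsum_empty]

theorem measurable_tsum_fiber_of_injOn (hS : MeasurableSet S) (hT : Continuous T)
    (hinj : InjOn T S) (hG : Measurable G) :
    Measurable fun y => ∑' z : ↥(T ⁻¹' {y} ∩ S), G z := by
  have hemb := hT.continuousOn.measurableEmbedding hS hinj
  convert! hemb.measurable_extend (hG.comp measurable_subtype_coe)
    (measurable_const (a := (0 : ℝ≥0∞))) using 1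
  ext y
  by_cases hy : y ∈ T '' S
  · obtain ⟨x, hx, rfl⟩ := hy
    rw [tsum_fiber_of_injOn hinj hx]
    exact (hemb.injective.extend_apply (G ∘ Subtype.val) _ ⟨x, hx⟩).symm
  · rw [tsum_fiber_of_notMem_image hy, Function.extend_apply']
    rintro ⟨x, hx⟩
    exact hy ⟨x, x.2, hx⟩

theorem setLIntegral_tsum_fiber_of_injOn (hS : MeasurableSet S) (hT : Differentiable ℝ T)
    (hinj : InjOn T S) {B : Set ℝ} (hB : MeasurableSet B) :
    ∫⁻ y in B, ∑' z : ↥(T ⁻¹' {y} ∩ S), G z =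
      ∫⁻ x in T ⁻¹' B ∩ S, ENNReal.ofReal |deriv T x| * G x := by
  have hBS : MeasurableSet (T ⁻¹' B ∩ S) := (hT.continuous.measurable hB).inter hS
  have himage : MeasurableSet (T '' S) :=
    hS.image_of_continuousOn_injOn hT.continuous.continuousOn hinj
  have hzero : ∫⁻ y in B \ T '' S, ∑' z : ↥(T ⁻¹' {y} ∩ S), G z = 0 :=
    setLIntegral_eq_zero (hB.diff himage) fun y hy => tsum_fiber_of_notMem_image hy.2
  rw [← lintegral_inter_add_sdiff _ B himage, hzero, add_zero, inter_comm,
    ← image_inter_preimage, inter_comm,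
    lintegral_image_eq_lintegral_abs_deriv_mul hBS
      (fun x _ => (hT x).hasDerivAt.hasDerivWithinAt) (hinj.mono inter_subset_right)]
  refine setLIntegral_congr_fun hBS fun x hx => ?_
  simp only [tsum_fiber_of_injOn hinj hx.2]

theorem exists_measurable_partition_injOn (hT : ContDiff ℝ 1 T) (hS : MeasurableSet S)
    (hderiv : ∀ x ∈ S, deriv T x ≠ 0) :
    ∃ A : ℕ → Set ℝ, (∀ n, MeasurableSet (A n)) ∧ Pairwise (Function.onFun Disjoint A) ∧
      (∀ n, InjOn T (A n)) ∧ ⋃ n, A n = S := by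
  set C : Set (Set ℝ) := insert ∅ {b ∈ TopologicalSpace.countableBasis ℝ | InjOn T b}
  have hCc : C.Countable :=
    ((TopologicalSpace.countable_countableBasis ℝ).mono (sep_subset _ _)).insert _
  obtain ⟨e, he⟩ := hCc.exists_eq_range (insert_nonempty _ _)
  have hmem (n : ℕ) : IsOpen (e n) ∧ InjOn T (e n) := by
    rcases (he ▸ mem_range_self n : e n ∈ C) with h | h
    · rw [h]; exact ⟨isOpen_empty, injOn_empty T⟩
    · exact ⟨TopologicalSpace.isOpen_of_mem_countableBasis h.1, h.2⟩
  refine ⟨fun n => disjointed e n ∩ S, fun n => ?_, fun m n hmn => ?_, fun n => ?_, ?_⟩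
  · exact (MeasurableSet.disjointed (fun k => (hmem k).1.measurableSet) n).inter hS
  · exact (disjoint_disjointed e hmn).mono inter_subset_left inter_subset_left
  · exact (hmem n).2.mono (inter_subset_left.trans (disjointed_subset e n))
  · rw [← iUnion_inter, iUnion_disjointed, inter_eq_right]
    intro x hx
    have hs := hT.hasStrictDerivAt (x := x) one_ne_zero
    obtain ⟨V, hV, hleft⟩ := Filter.eventually_iff_exists_mem.1
      (hs.eventually_left_inverse (hderiv x hx))
    obtain ⟨b, hb, hxb, hbV⟩ :=
      (TopologicalSpace.isBasis_countableBasis ℝ).mem_nhds_iff.1 hV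
    have hbC : b ∈ C := mem_insert_of_mem _
      ⟨hb, (LeftInvOn.injOn (s := V) fun z hz => hleft z hz).mono hbV⟩
    obtain ⟨n, rfl⟩ := he ▸ hbC
    exact mem_iUnion_of_mem n hxb

theorem tsum_fiber_iUnion {A : ℕ → Set ℝ} (hd : Pairwise (Function.onFun Disjoint A)) (y : ℝ) :
    ∑' z : ↥(T ⁻¹' {y} ∩ ⋃ n, A n), G z = ∑' n, ∑' z : ↥(T ⁻¹' {y} ∩ A n), G z := by
  rw [inter_iUnion]
  exact ENNReal.tsum_biUnion fun m _ n _ hmn =>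
    (hd hmn).mono inter_subset_right inter_subset_right

theorem measurable_tsum_fiber (hT : ContDiff ℝ 1 T) (hS : MeasurableSet S)
    (hderiv : ∀ x ∈ S, deriv T x ≠ 0) (hG : Measurable G) :
    Measurable fun y => ∑' z : ↥(T ⁻¹' {y} ∩ S), G z := by
  obtain ⟨A, hA, hd, hinj, rfl⟩ := exists_measurable_partition_injOn hT hS hderiv
  simp only [tsum_fiber_iUnion hd]
  exact Measurable.tsum fun n =>
    measurable_tsum_fiber_of_injOn (hA n) hT.continuous (hinj n) hG

/-- The area formula for a `C¹` map of the line, on a set without critical points. -/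
theorem setLIntegral_tsum_fiber (hT : ContDiff ℝ 1 T) (hS : MeasurableSet S)
    (hderiv : ∀ x ∈ S, deriv T x ≠ 0) (hG : Measurable G) {B : Set ℝ} (hB : MeasurableSet B) :
    ∫⁻ y in B, ∑' z : ↥(T ⁻¹' {y} ∩ S), G z =
      ∫⁻ x in T ⁻¹' B ∩ S, ENNReal.ofReal |deriv T x| * G x := by
  obtain ⟨A, hA, hd, hinj, rfl⟩ := exists_measurable_partition_injOn hT hS hderiv
  simp only [tsum_fiber_iUnion hd]
  rw [lintegral_tsum fun n => (measurable_tsum_fiber_of_injOn (hA n) hT.continuous (hinj n)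
      hG).aemeasurable, inter_iUnion,
    lintegral_iUnion (fun n => (hT.continuous.measurable hB).inter (hA n))
      fun m n hmn => (hd hmn).mono inter_subset_right inter_subset_right]
  exact tsum_congr fun n =>
    setLIntegral_tsum_fiber_of_injOn (hA n) (hT.differentiable one_ne_zero) (hinj n) hB

theorem IsCompact.finite_fiber_of_deriv_ne_zero {K : Set ℝ} (hK : IsCompact K)
    (hT : Differentiable ℝ T) {y : ℝ} (hy : ∀ x ∈ T ⁻¹' {y} ∩ K, deriv T x ≠ 0) :
    (T ⁻¹' {y} ∩ K).Finite := by
  by_contra hinf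
  have hcompact := hK.inter_left (isClosed_singleton (x := y) |>.preimage hT.continuous)
  obtain ⟨x, hx, hacc⟩ := Set.Infinite.exists_accPt_of_subset_isCompact hinf hcompact subset_rfl
  have hne := (hT x).hasDerivAt.eventually_ne (c := y) (hy x hx)
  obtain ⟨z, hz, hzy⟩ := ((accPt_iff_frequently_nhdsNE.1 hacc).and_eventually hne).exists
  exact hzy hz.1

end FiberSum

/-- Pushforward density formula for a non-injective C¹ transport on ℝ with finitely many
critical points in `[0,1]`: the image measure is absolutely continuous, almost every fiber
is finite and free of critical points, and the density is the sum over preimages of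
`f_μ(x)/|T'(x)|`. -/
theorem pushforward_density_noninjective
    (T : ℝ → ℝ) (hT : ContDiff ℝ 1 T)
    (fμ : ℝ → ℝ) (hf0 : ∀ x, 0 ≤ fμ x) (hfi : Integrable fμ)
    (hsupp : ∀ x ∉ Icc (0:ℝ) 1, fμ x = 0)
    (hcrit : {x ∈ Icc (0:ℝ) 1 | deriv T x = 0}.Finite)
    (ν : Measure ℝ)
    (hν : ν = Measure.map T
      ((volume.restrict (Icc (0:ℝ) 1)).withDensity (fun x => ENNReal.ofReal (fμ x))))
    (g : ℝ → ℝ)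
    (hg : ∀ y, g y = ∑' x : ↥(T ⁻¹' {y} ∩ Icc (0:ℝ) 1), fμ ↑x / |deriv T ↑x|) :
    ν ≪ volume ∧
    (∀ᵐ y ∂(volume : Measure ℝ),
      (T ⁻¹' {y} ∩ Icc (0:ℝ) 1).Finite ∧
      ∀ x ∈ T ⁻¹' {y} ∩ Icc (0:ℝ) 1, deriv T x ≠ 0) ∧
    (∀ᵐ y ∂(volume : Measure ℝ), ν.rnDeriv volume y = ENNReal.ofReal (g y)) := by
  have hdiff : Differentiable ℝ T := hT.differentiable one_ne_zero
  set crit := {x ∈ Icc (0:ℝ) 1 | deriv T x = 0}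
  set S := Icc (0:ℝ) 1 \ crit
  have hS : MeasurableSet S := measurableSet_Icc.diff hcrit.measurableSet
  have hSderiv : ∀ x ∈ S, deriv T x ≠ 0 := fun x hx h => hx.2 ⟨hx.1, h⟩
  have hfiber : ∀ᵐ y ∂(volume : Measure ℝ), ∀ x ∈ T ⁻¹' {y} ∩ Icc (0:ℝ) 1, deriv T x ≠ 0 := by
    filter_upwards [compl_mem_ae_iff.2 ((hcrit.image T).measure_zero volume)] with y hy x hx h
    exact hy ⟨x, ⟨hx.2, h⟩, hx.1⟩
  obtain ⟨f, hfm, hff⟩ := hfi.aemeasurable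
  set G : ℝ → ℝ≥0∞ := fun x => ENNReal.ofReal (f x / |deriv T x|) with hG_def
  have hG : Measurable G := (hfm.div (measurable_deriv T).abs).ennreal_ofReal
  have hν_eq : ν = volume.withDensity fun y => ∑' z : ↥(T ⁻¹' {y} ∩ S), G z := by
    ext B hB
    have hTB : MeasurableSet (T ⁻¹' B) := hT.continuous.measurable hB
    have hSIcc : (T ⁻¹' B ∩ Icc (0:ℝ) 1 : Set ℝ) =ᵐ[volume] (T ⁻¹' B ∩ S : Set ℝ) :=
      (Filter.EventuallyEq.refl _ _).inter
        (sdiff_null_ae_eq_self (hcrit.measure_zero volume)).symm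
    rw [hν, Measure.map_apply hT.continuous.measurable hB, withDensity_apply _ hTB,
      withDensity_apply _ hB, Measure.restrict_restrict hTB, setLIntegral_congr hSIcc,
      setLIntegral_tsum_fiber hT hS hSderiv hG hB]
    refine setLIntegral_congr_fun_ae (hTB.inter hS) ?_
    filter_upwards [hff] with x hx hxS
    rw [hx, ← ENNReal.ofReal_mul (abs_nonneg _),
      mul_div_cancel₀ _ (abs_ne_zero.2 (hSderiv x hxS.2))]
  have hfinite : ∀ᵐ y ∂(volume : Measure ℝ), (T ⁻¹' {y} ∩ Icc (0:ℝ) 1).Finite ∧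
      ∀ x ∈ T ⁻¹' {y} ∩ Icc (0:ℝ) 1, deriv T x ≠ 0 :=
    hfiber.mono fun y hy => ⟨isCompact_Icc.finite_fiber_of_deriv_ne_zero hdiff hy, hy⟩
  refine ⟨hν_eq ▸ withDensity_absolutelyContinuous _ _, hfinite, ?_⟩
  have hmodify : ∀ᵐ y ∂(volume : Measure ℝ), ∀ x ∈ T ⁻¹' {y}, fμ x = f x := by
    have hnull := addHaar_image_eq_zero_of_differentiableOn_of_addHaar_eq_zero volume
      hdiff.differentiableOn (ae_iff.1 hff)
    filter_upwards [compl_mem_ae_iff.2 hnull] with y hy x hx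
    by_contra h
    exact hy ⟨x, h, hx⟩
  rw [hν_eq]
  filter_upwards [Measure.rnDeriv_withDensity volume
    (measurable_tsum_fiber hT hS hSderiv hG), hfinite, hmodify] with y hy hfin hfy
  have hfib : T ⁻¹' {y} ∩ S = T ⁻¹' {y} ∩ Icc (0:ℝ) 1 :=
    Subset.antisymm (inter_subset_inter_right _ sdiff_subset)
      fun x hx => ⟨hx.1, hx.2, fun h => hfin.2 x hx h.2⟩
  have : Finite ↥(T ⁻¹' {y} ∩ Icc (0:ℝ) 1) := hfin.1
  rw [hy, hfib, hg, ENNReal.ofReal_tsum_of_nonneg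
    (fun x : ↥(T ⁻¹' {y} ∩ Icc (0:ℝ) 1) => div_nonneg (hf0 x) (abs_nonneg _)) Summable.of_finite]
  exact tsum_congr fun x => by rw [hG_def, hfy x x.2.1]
end

section
/- Let I ⊆ ℝ be an interval, let T : ℝ → ℝ be differentiable on I with derivative T' strictly decreasing on I (i.e. T is strictly concave on I), and let τ > 0. Then the delay map d(x) = (T(x − τ), T(x)) is injective on the set { x : x ∈ I and x − τ ∈ I }. -/
open Set

/-- A function on an interval whose derivative within the interval is strictly decreasing is
strictly concave there. -/
theorem StrictAntiOn.strictConcaveOn_of_hasDerivWithinAt {I : Set ℝ} (hI : Convex ℝ I)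
    {f f' : ℝ → ℝ} (hf : ∀ x ∈ I, HasDerivWithinAt f (f' x) I x) (hf' : StrictAntiOn f' I) :
    StrictConcaveOn ℝ I f :=
  ((hf'.mono interior_subset).congr fun x hx =>
    ((hf x (interior_subset hx)).hasDerivAt (mem_interior_iff_mem_nhds.1 hx)).deriv.symm)
    |>.strictConcaveOn_of_deriv hI fun x hx => (hf x hx).continuousWithinAt

/-- The increments of a strictly concave function over a fixed length are strictly decreasing. -/
theorem StrictConcaveOn.add_lt_add_of_shift {I : Set ℝ} {f : ℝ → ℝ} (hf : StrictConcaveOn ℝ I f)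
    {x y τ : ℝ} (hτ : 0 < τ) (hxy : x < y) (hx : x - τ ∈ I) (hy : y ∈ I) :
    f (x - τ) + f y < f x + f (y - τ) := by
  have hL : 0 < y - x + τ := by linarith
  have ha : 0 < (y - x) / (y - x + τ) := div_pos (sub_pos.2 hxy) hL
  have hb : 0 < τ / (y - x + τ) := div_pos hτ hL
  have hab : (y - x) / (y - x + τ) + τ / (y - x + τ) = 1 := by field_simp
  have hne : x - τ ≠ y := by linarith
  have h₁ := hf.2 hx hy hne ha hb hab
  have h₂ := hf.2 hx hy hne hb ha (by rwa [add_comm])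
  have e₁ : (y - x) / (y - x + τ) * (x - τ) + τ / (y - x + τ) * y = x := by
    field_simp
    ring
  have e₂ : τ / (y - x + τ) * (x - τ) + (y - x) / (y - x + τ) * y = y - τ := by
    field_simp
    ring
  simp only [smul_eq_mul, e₁, e₂] at h₁ h₂
  linear_combination h₁ + h₂ - (f (x - τ) + f y) * hab

/-- For a strictly concave observable `T` (differentiable on an interval `I` with strictly
decreasing derivative), a single time delay suffices: the delay map
`d(x) = (T(x−τ), T(x))` is injective on `{x : x ∈ I ∧ x − τ ∈ I}`. -/
theorem delay_map_injective_of_strict_concave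
    (I : Set ℝ) (hI : I.OrdConnected)
    (T T' : ℝ → ℝ)
    (hT : ∀ x ∈ I, HasDerivWithinAt T (T' x) I x)
    (hT' : StrictAntiOn T' I)
    (τ : ℝ) (hτ : 0 < τ) :
    InjOn (fun x => (T (x - τ), T x)) {x | x ∈ I ∧ x - τ ∈ I} := by
  have hconc := hT'.strictConcaveOn_of_hasDerivWithinAt hI.convex hT
  rintro x ⟨hx, hxτ⟩ y ⟨hy, hyτ⟩ hxy
  obtain ⟨h₁, h₂⟩ := Prod.mk.inj hxy
  rcases lt_trichotomy x y with h | h | h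
  · linarith [hconc.add_lt_add_of_shift hτ h hxτ hy]
  · exact h
  · linarith [hconc.add_lt_add_of_shift hτ h hyτ hx]
end

section
/- Let T : [0,1] → ℝ be continuously differentiable with a unique critical point x* ∈ (0,1), with T' > 0 on [0,x*) and T' < 0 on (x*,1], and let f_μ : [0,1] → ℝ be continuous with f_μ(x*) > 0. Define g(y) = Σ_{x ∈ T⁻¹(y) ∩ [0,1]} f_μ(x)/|T'(x)| for y < T(x*) with y > max(T(0), T(1)). Then g(y) → ∞ as y → T(x*)⁻. In other words, the pushforward density of f_μ·λ under the fold map T diverges to infinity at the fold value T(x*). -/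
open MeasureTheory Set Filter

/-- The pushforward density of a continuous density under a C¹ fold map `T` with a unique
interior critical point `x*` (increasing then decreasing) diverges to `∞` as
`y → T(x*)⁻` (within the range of fold values `(max(T(0),T(1)), T(x*))`),
provided `f_μ(x*) > 0`. -/
theorem fold_density_diverges_at_fold
    (T T' : ℝ → ℝ) (xs : ℝ) (hxs : xs ∈ Ioo (0:ℝ) 1)
    (hT : ∀ x ∈ Icc (0:ℝ) 1, HasDerivWithinAt T (T' x) (Icc (0:ℝ) 1) x)
    (hT'c : ContinuousOn T' (Icc (0:ℝ) 1))
    (hpos : ∀ x ∈ Ico (0:ℝ) xs, 0 < T' x)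
    (hzero : T' xs = 0)
    (hneg : ∀ x ∈ Ioc xs 1, T' x < 0)
    (fμ : ℝ → ℝ) (hfc : ContinuousOn fμ (Icc (0:ℝ) 1)) (hfxs : 0 < fμ xs)
    (g : ℝ → ℝ)
    (hg : ∀ y, max (T 0) (T 1) < y → y < T xs →
      g y = ∑' x : ↥(T ⁻¹' {y} ∩ Icc (0:ℝ) 1), fμ ↑x / |T' ↑x|) :
    Tendsto g (nhdsWithin (T xs) (Ioo (max (T 0) (T 1)) (T xs))) atTop := by
  have hmono : StrictMonoOn T (Icc 0 xs) := by
    refine strictMonoOn_of_hasDerivWithinAt_pos (f' := T') (convex_Icc _ _)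
      (fun x hx => ((hT x ⟨hx.1, hx.2.trans hxs.2.le⟩).mono
        (Icc_subset_Icc_right hxs.2.le)).continuousWithinAt) ?_ ?_ <;> rw [interior_Icc]
    · exact fun x hx => (hT x ⟨hx.1.le, (hx.2.trans hxs.2).le⟩).mono
        fun z hz => ⟨hz.1.le, (hz.2.trans hxs.2).le⟩
    · exact fun x hx => hpos x ⟨hx.1.le, hx.2⟩
  have hanti : StrictAntiOn T (Icc xs 1) := by
    refine strictAntiOn_of_hasDerivWithinAt_neg (f' := T') (convex_Icc _ _)
      (fun x hx => ((hT x ⟨hxs.1.le.trans hx.1, hx.2⟩).mono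
        (Icc_subset_Icc_left hxs.1.le)).continuousWithinAt) ?_ ?_ <;> rw [interior_Icc]
    · exact fun x hx => (hT x ⟨(hxs.1.trans hx.1).le, hx.2.le⟩).mono
        fun z hz => ⟨(hxs.1.trans hz.1).le, hz.2.le⟩
    · exact fun x hx => hneg x ⟨hx.1, hx.2.le⟩
  have hTc : ContinuousOn T (Icc 0 1) := fun x hx => (hT x hx).continuousWithinAt
  have hxs' : xs ∈ Icc (0:ℝ) 1 := Ioo_subset_Icc_self hxs
  rw [tendsto_atTop]
  intro M
  have hbound : ∀ᶠ x in nhds xs, M * |T' x| < fμ x ∧ 0 < fμ x := by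
    rw [← nhdsWithin_eq_nhds.2 (Icc_mem_nhds hxs.1 hxs.2)]
    have hM := (hT'c xs hxs').abs.const_mul M
    refine (hM.eventually_lt (hfc xs hxs') ?_).and
      (continuousWithinAt_const.eventually_lt (hfc xs hxs') hfxs)
    simpa [hzero] using hfxs
  obtain ⟨a, b, ⟨hax, hxb⟩, hab⟩ := mem_nhds_iff_exists_Ioo_subset.1
    (hbound.and (Ioo_mem_nhds hxs.1 hxs.2))
  obtain ⟨l, hal, hlx⟩ := exists_between (max_lt hax hxs.1)
  obtain ⟨r, hxr, hrb⟩ := exists_between (lt_min hxb hxs.2)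
  rw [max_lt_iff] at hal
  rw [lt_min_iff] at hrb
  have hTl : T l < T xs := hmono ⟨hal.2.le, hlx.le⟩ ⟨hxs.1.le, le_rfl⟩ hlx
  have hTr : T r < T xs := hanti ⟨le_rfl, hxs.2.le⟩ ⟨hxr.le, hrb.2.le⟩ hxr
  filter_upwards [self_mem_nhdsWithin, nhdsWithin_le_nhds (Ioi_mem_nhds hTl),
    nhdsWithin_le_nhds (Ioi_mem_nhds hTr)] with y hy hly hry
  rw [hg y hy.1 hy.2]
  have hpre : ∀ x ∈ T ⁻¹' {y} ∩ Icc (0:ℝ) 1, M ≤ fμ x / |T' x| ∧ 0 ≤ fμ x / |T' x| := by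
    rintro x ⟨hxy, hx⟩
    rw [mem_preimage, mem_singleton_iff] at hxy
    have hne : x ≠ xs := by
      rintro rfl
      exact hy.2.ne' hxy
    have hlx' : l < x := by
      by_contra! h
      have := hmono.monotoneOn ⟨hx.1, h.trans hlx.le⟩ ⟨hal.2.le, hlx.le⟩ h
      exact (hxy ▸ this).not_gt hly
    have hxr' : x < r := by
      by_contra! h
      have := hanti.antitoneOn ⟨hxr.le, hrb.2.le⟩ ⟨hxr.le.trans h, hx.2⟩ h
      exact (hxy ▸ this).not_gt hry
    have hT0 : 0 < |T' x| := by
      rcases lt_or_gt_of_ne hne with h | h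
      · exact abs_pos.2 (hpos x ⟨hx.1, h⟩).ne'
      · exact abs_pos.2 (hneg x ⟨h, hx.2⟩).ne
    obtain ⟨h1, h2⟩ := (hab ⟨hal.1.trans hlx', hxr'.trans hrb.1⟩).1
    exact ⟨(le_div_iff₀ hT0).2 h1.le, (div_pos h2 hT0).le⟩
  have hfin : (T ⁻¹' {y} ∩ Icc (0:ℝ) 1).Finite := by
    have hl : (T ⁻¹' {y} ∩ Icc 0 xs).Subsingleton := fun u hu v hv =>
      hmono.injOn hu.2 hv.2 (hu.1.trans hv.1.symm)
    have hr : (T ⁻¹' {y} ∩ Icc xs 1).Subsingleton := fun u hu v hv =>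
      hanti.injOn hu.2 hv.2 (hu.1.trans hv.1.symm)
    rw [← Icc_union_Icc_eq_Icc hxs.1.le hxs.2.le, inter_union_distrib_left]
    exact hl.finite.union hr.finite
  obtain ⟨x, hx, hxy⟩ := intermediate_value_Icc hxs.1.le
    (hTc.mono (Icc_subset_Icc_right hxs.2.le)) ⟨((le_max_left _ _).trans_lt hy.1).le, hy.2.le⟩
  have hmem : x ∈ T ⁻¹' {y} ∩ Icc (0:ℝ) 1 := ⟨hxy, hx.1, hx.2.trans hxs.2.le⟩
  have := hfin.to_subtype
  exact (hpre x hmem).1.trans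
    ((Summable.of_finite (f := fun x : ↥(T ⁻¹' {y} ∩ Icc (0:ℝ) 1) => fμ x / |T' x|)).le_tsum
      ⟨x, hmem⟩ fun z _ => (hpre z z.2).2)
end

section
/- Let T : [0,1] → ℝ be continuously differentiable with a unique critical point x* ∈ (0,1), with T' > 0 on [0,x*) and T' < 0 on (x*,1], and assume T(0) < T(1) < T(x*) and T'(1) ≠ 0. Let f_μ : [0,1] → ℝ be continuous. Define g(y) = Σ_{x ∈ T⁻¹(y) ∩ [0,1]} f_μ(x)/|T'(x)| for y ∈ (T(0), T(x*)) \ {T(1)}. Then the one-sided limits of g at T(1) exist and satisfy lim_{y→T(1)⁺} g(y) − lim_{y→T(1)⁻} g(y) = f_μ(1)/|T'(1)|. In particular, if f_μ(1) > 0, then g has a jump discontinuity at T(1). -/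
open MeasureTheory Set Filter

/-- A right inverse of a continuous injective map on a compact set, with values in that set,
is continuous. -/
theorem IsCompact.tendsto_rightInvOn {X Y : Type*} [TopologicalSpace X] [TopologicalSpace Y]
    [T2Space Y] {K : Set X} (hK : IsCompact K) {f : X → Y} (hf : ContinuousOn f K)
    (hinj : InjOn f K) {s : Set Y} {φ : Y → X} (hφ : MapsTo φ s K) (hr : RightInvOn φ f s)
    {x₀ : X} (hx₀ : x₀ ∈ K) :
    Tendsto φ (nhdsWithin (f x₀) s) (nhdsWithin x₀ K) := by
  have hmem : ∀ᶠ y in nhdsWithin (f x₀) s, φ y ∈ K :=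
    eventually_nhdsWithin_of_forall hφ
  refine tendsto_nhdsWithin_iff.2 ⟨hK.tendsto_nhds_of_unique_mapClusterPt hmem ?_, hmem⟩
  intro x hx hc
  refine hinj hx hx₀ ?_
  have hle : nhds x ⊓ map φ (nhdsWithin (f x₀) s) ≤ nhdsWithin x K :=
    inf_le_inf_left _ (le_principal_iff.2 hmem)
  have hfc : MapClusterPt (f x) (nhdsWithin (f x₀) s) (f ∘ φ) :=
    hc.tendsto_comp' ((hf x hx).mono_left hle)
  have hlim : Tendsto (f ∘ φ) (nhdsWithin (f x₀) s) (nhds (f x₀)) :=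
    (tendsto_id.mono_left nhdsWithin_le_nhds).congr'
      (eventually_nhdsWithin_of_forall fun y hy => (hr hy).symm)
  have : (nhds (f x) ⊓ nhds (f x₀)).NeBot := hfc.neBot.mono (inf_le_inf_left _ hlim)
  exact eq_of_nhds_neBot this

/-- The pushforward density of a continuous density under a C¹ fold map `T`
(unique interior critical point `x*`, increasing then decreasing, with
`T(0) < T(1) < T(x*)` and `T'(1) ≠ 0`) has one-sided limits at the boundary value `T(1)`
whose difference equals `f_μ(1)/|T'(1)|`; in particular it has a jump discontinuity at
`T(1)` whenever `f_μ(1) > 0`. -/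
theorem fold_density_jump_discontinuity
    (T T' : ℝ → ℝ) (xs : ℝ) (hxs : xs ∈ Ioo (0:ℝ) 1)
    (hT : ∀ x ∈ Icc (0:ℝ) 1, HasDerivWithinAt T (T' x) (Icc (0:ℝ) 1) x)
    (hT'c : ContinuousOn T' (Icc (0:ℝ) 1))
    (hpos : ∀ x ∈ Ico (0:ℝ) xs, 0 < T' x)
    (hzero : T' xs = 0)
    (hneg : ∀ x ∈ Ioc xs 1, T' x < 0)
    (horder₁ : T 0 < T 1) (horder₂ : T 1 < T xs) (hT'1 : T' 1 ≠ 0)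
    (fμ : ℝ → ℝ) (hfc : ContinuousOn fμ (Icc (0:ℝ) 1))
    (g : ℝ → ℝ)
    (hg : ∀ y ∈ Ioo (T 0) (T xs) \ {T 1},
      g y = ∑' x : ↥(T ⁻¹' {y} ∩ Icc (0:ℝ) 1), fμ ↑x / |T' ↑x|) :
    ∃ Lm Lp : ℝ,
      Tendsto g (nhdsWithin (T 1) (Iio (T 1))) (nhds Lm) ∧
      Tendsto g (nhdsWithin (T 1) (Ioi (T 1))) (nhds Lp) ∧
      Lp - Lm = fμ 1 / |T' 1| ∧
      (0 < fμ 1 → Lm ≠ Lp) := by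
  obtain ⟨h0s, hs1⟩ := hxs
  have hsubL : Icc 0 xs ⊆ Icc (0:ℝ) 1 := Icc_subset_Icc_right hs1.le
  have hsubR : Icc xs 1 ⊆ Icc (0:ℝ) 1 := Icc_subset_Icc_left h0s.le
  have hTc : ContinuousOn T (Icc 0 1) := fun x hx => (hT x hx).continuousWithinAt
  have hTL := hTc.mono hsubL
  have hTR := hTc.mono hsubR
  have hmono : StrictMonoOn T (Icc 0 xs) :=
    strictMonoOn_of_hasDerivWithinAt_pos (f' := T') (convex_Icc _ _) hTL
      (fun x hx => (hT x (hsubL (interior_subset hx))).mono (interior_subset.trans hsubL))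
      (fun x hx => by rw [interior_Icc] at hx; exact hpos x ⟨hx.1.le, hx.2⟩)
  have hanti : StrictAntiOn T (Icc xs 1) :=
    strictAntiOn_of_hasDerivWithinAt_neg (f' := T') (convex_Icc _ _) hTR
      (fun x hx => (hT x (hsubR (interior_subset hx))).mono (interior_subset.trans hsubR))
      (fun x hx => by rw [interior_Icc] at hx; exact hneg x ⟨hx.1, hx.2.le⟩)
  have hexL : ∀ y ∈ Icc (T 0) (T xs), ∃ x ∈ Icc 0 xs, T x = y := fun y hy =>
    intermediate_value_Icc h0s.le hTL hy
  have hexR : ∀ y ∈ Icc (T 1) (T xs), ∃ x ∈ Icc xs 1, T x = y := fun y hy =>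
    intermediate_value_Icc' hs1.le hTR hy
  choose! a haK haT using hexL
  choose! b hbK hbT using hexR
  have hT1 : T 1 ∈ Icc (T 0) (T xs) := ⟨horder₁.le, horder₂.le⟩
  have ha₁ : a (T 1) ∈ Ico 0 xs := by
    refine ⟨(haK _ hT1).1, (haK _ hT1).2.lt_of_ne fun h => ?_⟩
    have := haT _ hT1
    rw [h] at this
    exact horder₂.ne' this
  have haT1 := haT _ hT1
  set F : ℝ → ℝ := fun x => fμ x / |T' x| with hF
  have hFc : ∀ x ∈ Icc (0:ℝ) 1, T' x ≠ 0 → ContinuousWithinAt F (Icc 0 1) x :=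
    fun x hx hne => (hfc x hx).div (hT'c x hx).abs (abs_ne_zero.2 hne)
  have hFa : Tendsto (fun y => F (a y)) (nhdsWithin (T 1) (Icc (T 0) (T xs)))
      (nhds (F (a (T 1)))) := by
    have h := isCompact_Icc.tendsto_rightInvOn hTL hmono.injOn haK haT (haK _ hT1)
    rw [haT1] at h
    exact ((hFc _ (hsubL (haK _ hT1)) (hpos _ ha₁).ne').mono hsubL).tendsto.comp h
  have hFb : Tendsto (fun y => F (b y)) (nhdsWithin (T 1) (Icc (T 1) (T xs))) (nhds (F 1)) := by
    have h1 : (1:ℝ) ∈ Icc xs 1 := ⟨hs1.le, le_rfl⟩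
    have h := isCompact_Icc.tendsto_rightInvOn hTR hanti.injOn hbK hbT h1
    exact ((hFc _ (hsubR h1) hT'1).mono hsubR).tendsto.comp h
  have hg_left : ∀ y ∈ Ioo (T 0) (T 1), g y = F (a y) := by
    intro y hy
    have hyI : y ∈ Icc (T 0) (T xs) := ⟨hy.1.le, (hy.2.trans horder₂).le⟩
    have hfib : T ⁻¹' {y} ∩ Icc 0 1 = {a y} := by
      ext x
      simp only [mem_inter_iff, mem_preimage, mem_singleton_iff]
      refine ⟨fun ⟨hx, hx01⟩ => ?_, fun hx => hx ▸ ⟨haT y hyI, hsubL (haK y hyI)⟩⟩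
      rcases le_total x xs with h | h
      · exact hmono.injOn ⟨hx01.1, h⟩ (haK y hyI) (hx.trans (haT y hyI).symm)
      · have := hanti.antitoneOn ⟨h, hx01.2⟩ ⟨hs1.le, le_rfl⟩ hx01.2
        exact absurd (hx ▸ this) hy.2.not_ge
    rw [hg y ⟨⟨hy.1, hy.2.trans horder₂⟩, hy.2.ne⟩, hfib]
    exact tsum_singleton (a y) F
  have hg_right : ∀ y ∈ Ioo (T 1) (T xs), g y = F (a y) + F (b y) := by
    intro y hy
    have hyI : y ∈ Icc (T 0) (T xs) := ⟨(horder₁.trans hy.1).le, hy.2.le⟩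
    have hyJ : y ∈ Icc (T 1) (T xs) := ⟨hy.1.le, hy.2.le⟩
    have hab : a y ≠ b y := by
      intro h
      have hxs : a y = xs := le_antisymm (haK y hyI).2 (h ▸ (hbK y hyJ).1)
      have := haT y hyI
      rw [hxs] at this
      exact hy.2.ne' this
    have hfib : T ⁻¹' {y} ∩ Icc 0 1 = (({a y, b y} : Finset ℝ) : Set ℝ) := by
      ext x
      simp only [mem_inter_iff, mem_preimage, mem_singleton_iff, Finset.coe_insert,
        Finset.coe_singleton, mem_insert_iff]
      constructor
      · rintro ⟨hx, hx01⟩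
        rcases le_total x xs with h | h
        · exact .inl (hmono.injOn ⟨hx01.1, h⟩ (haK y hyI) (hx.trans (haT y hyI).symm))
        · exact .inr (hanti.injOn ⟨h, hx01.2⟩ (hbK y hyJ) (hx.trans (hbT y hyJ).symm))
      · rintro (rfl | rfl)
        · exact ⟨haT y hyI, hsubL (haK y hyI)⟩
        · exact ⟨hbT y hyJ, hsubR (hbK y hyJ)⟩
    rw [hg y ⟨⟨horder₁.trans hy.1, hy.2⟩, hy.1.ne'⟩, hfib]
    exact (Finset.tsum_subtype' {a y, b y} F).trans (Finset.sum_pair hab)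
  refine ⟨F (a (T 1)), F (a (T 1)) + F 1, ?_, ?_, by simp [hF], fun hf1 => ?_⟩
  · rw [← nhdsWithin_Ioo_eq_nhdsLT horder₁]
    refine (hFa.mono_left (nhdsWithin_mono _ ?_)).congr'
      (eventually_nhdsWithin_of_forall fun y hy => (hg_left y hy).symm)
    exact Ioo_subset_Icc_self.trans (Icc_subset_Icc_right horder₂.le)
  · rw [← nhdsWithin_Ioo_eq_nhdsGT horder₂]
    refine Tendsto.congr'
      (eventually_nhdsWithin_of_forall fun y hy => (hg_right y hy).symm) (Tendsto.add ?_ ?_)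
    · exact hFa.mono_left
        (nhdsWithin_mono _ (Ioo_subset_Icc_self.trans (Icc_subset_Icc_left horder₁.le)))
    · exact hFb.mono_left (nhdsWithin_mono _ Ioo_subset_Icc_self)
  · have : 0 < F 1 := div_pos hf1 (abs_pos.2 hT'1)
    linarith
end

section
/- Let f_μ be continuous and strictly positive on [0,1] with ∫₀¹ f_μ dλ = 1 and f_μ = 0 outside [0,1], and let f_ν be a probability density supported on an interval [a₀, c₀], strictly positive on (a₀, c₀), continuous on (a₀, c₀) except at a point a ∈ (a₀, c₀), where it has one-sided limits L⁻ = lim_{y→a⁻} f_ν(y) and L⁺ = lim_{y→a⁺} f_ν(y) that are finite, positive, and distinct. Let W(x) = inf{ y : F_ν(y) ≥ F_μ(x) } be the nondecreasing transport pushing f_μ·λ to f_ν·λ, and let x₀ ∈ (0,1) be the point with W(x₀) = a. Then W has one-sided derivatives at x₀ equal to f_μ(x₀)/L⁻ from the left and f_μ(x₀)/L⁺ from the right; since these differ, W is not differentiable at x₀. -/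
open MeasureTheory Set Filter

open scoped Topology

section Cdf

variable {f F : ℝ → ℝ}

lemma cdf_sub_cdf (hf : Integrable f) (hF : ∀ x, F x = ∫ t in Iic x, f t) (x y : ℝ) :
    F y - F x = ∫ t in x..y, f t := by
  rw [hF, hF, intervalIntegral.integral_Iic_sub_Iic hf.integrableOn hf.integrableOn]

lemma cdf_eq_add_intervalIntegral (hf : Integrable f) (hF : ∀ x, F x = ∫ t in Iic x, f t)
    (x : ℝ) : F = fun y => F x + ∫ t in x..y, f t := by
  ext y
  linarith [cdf_sub_cdf hf hF x y]

lemma continuous_cdf (hf : Integrable f) (hF : ∀ x, F x = ∫ t in Iic x, f t) : Continuous F := by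
  rw [cdf_eq_add_intervalIntegral hf hF 0]
  exact continuous_const.add (hf.continuous_primitive 0)

lemma monotone_cdf (hf : Integrable f) (hnn : ∀ x, 0 ≤ f x)
    (hF : ∀ x, F x = ∫ t in Iic x, f t) : Monotone F := fun x y hxy => by
  have := intervalIntegral.integral_nonneg (μ := volume) hxy fun t _ => hnn t
  linarith [cdf_sub_cdf hf hF x y]

lemma strictMonoOn_cdf {a c : ℝ} (hf : Integrable f) (hpos : ∀ x ∈ Ioo a c, 0 < f x)
    (hF : ∀ x, F x = ∫ t in Iic x, f t) : StrictMonoOn F (Icc a c) := fun x hx y hy hxy => by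
  have := intervalIntegral.intervalIntegral_pos_of_pos_on (hf.intervalIntegrable (a := x) (b := y))
    (fun t ht => hpos t ⟨hx.1.trans_lt ht.1, ht.2.trans_le hy.2⟩) hxy
  linarith [cdf_sub_cdf hf hF x y]

lemma cdf_eq_one {a c : ℝ} (h0 : ∀ x ∉ Icc a c, f x = 0) (h1 : ∫ x, f x = 1)
    (hF : ∀ x, F x = ∫ t in Iic x, f t) : F c = 1 := by
  rw [hF, setIntegral_eq_integral_of_forall_compl_eq_zero, h1]
  exact fun x hx => h0 x fun h => hx h.2

lemma cdf_eq_zero {a c : ℝ} (h0 : ∀ x ∉ Icc a c, f x = 0)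
    (hF : ∀ x, F x = ∫ t in Iic x, f t) : F a = 0 := by
  rw [hF, integral_Iic_eq_integral_Iio]
  exact setIntegral_eq_zero_of_forall_eq_zero fun x hx => h0 x fun h => not_lt.2 h.1 hx

lemma nhdsLE_inf_ae_le (a : ℝ) : 𝓝[≤] a ⊓ ae volume ≤ 𝓝[<] a := by
  have h : ∀ᵐ x : ℝ, x ≠ a := Measure.ae_ne volume a
  refine le_inf (inf_le_left.trans inf_le_left) (le_principal_iff.2 ?_)
  filter_upwards [(inf_le_left : 𝓝[≤] a ⊓ ae volume ≤ _) self_mem_nhdsWithin,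
    (inf_le_right : 𝓝[≤] a ⊓ ae volume ≤ _) h] with x hx hxa
  exact lt_of_le_of_ne hx hxa

lemma hasDerivWithinAt_Iio_cdf {a L : ℝ} (hf : Integrable f)
    (hF : ∀ x, F x = ∫ t in Iic x, f t) (hL : Tendsto f (𝓝[<] a) (𝓝 L)) :
    HasDerivWithinAt F L (Iio a) a := by
  rw [cdf_eq_add_intervalIntegral hf hF 0]
  exact ((intervalIntegral.integral_hasDerivWithinAt_of_tendsto_ae_right (s := Iic a) (t := Iic a)
    hf.intervalIntegrable hf.aestronglyMeasurable.stronglyMeasurableAtFilter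
    (hL.mono_left (nhdsLE_inf_ae_le a))).mono Iio_subset_Iic_self).const_add _

lemma hasDerivWithinAt_Ioi_cdf {a L : ℝ} (hf : Integrable f)
    (hF : ∀ x, F x = ∫ t in Iic x, f t) (hL : Tendsto f (𝓝[>] a) (𝓝 L)) :
    HasDerivWithinAt F L (Ioi a) a := by
  rw [cdf_eq_add_intervalIntegral hf hF 0]
  exact ((intervalIntegral.integral_hasDerivWithinAt_of_tendsto_ae_right (s := Ici a) (t := Ioi a)
    hf.intervalIntegrable hf.aestronglyMeasurable.stronglyMeasurableAtFilter
    (hL.mono_left inf_le_left)).mono Ioi_subset_Ici_self).const_add _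

end Cdf

lemma quantile_mem_Ioo_and_eq {F : ℝ → ℝ} {a c p : ℝ} (hac : a ≤ c) (hcont : Continuous F)
    (hmono : Monotone F) (hstrict : StrictMonoOn F (Icc a c)) (hp : p ∈ Ioo (F a) (F c)) :
    sInf {y : ℝ | F y ≥ p} ∈ Ioo a c ∧ F (sInf {y : ℝ | F y ≥ p}) = p := by
  obtain ⟨y, hy, rfl⟩ := intermediate_value_Ioo hac hcont.continuousOn hp
  have hset : {z : ℝ | F z ≥ F y} = Ici y := by
    ext z
    refine ⟨fun hz => ?_, fun hz => hmono hz⟩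
    by_contra hlt
    have hlt : z < y := not_le.1 hlt
    have hmax : max z a < y := max_lt hlt hy.1
    have h := hstrict ⟨le_max_right z a, hmax.le.trans hy.2.le⟩ (Ioo_subset_Icc_self hy) hmax
    exact absurd ((hmono (le_max_left z a)).trans_lt h) (not_lt.2 hz)
  rw [hset, csInf_Ici]
  exact ⟨hy, rfl⟩

/-- If `F ∘ W = G` near `x` within `s`, a one-sided derivative of `W` is the quotient of those of
`G` and `F`. -/
lemma HasDerivWithinAt.div_of_comp_eventuallyEq {F G W : ℝ → ℝ} {s t : Set ℝ} {x g L : ℝ}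
    (hG : HasDerivWithinAt G g s x) (hF : HasDerivWithinAt F L t (W x)) (hL : L ≠ 0)
    (hW : Tendsto W (𝓝[s] x) (𝓝[t] (W x))) (hxs : x ∉ s) (hxt : W x ∉ t)
    (hx : F (W x) = G x) (hFW : ∀ᶠ z in 𝓝[s] x, F (W z) = G z) :
    HasDerivWithinAt W (g / L) s x := by
  rw [hasDerivWithinAt_iff_tendsto_slope' hxs] at hG ⊢
  rw [hasDerivWithinAt_iff_tendsto_slope' hxt] at hF
  have hcomp := hF.comp hW
  refine (hG.div hcomp hL).congr' ?_
  filter_upwards [hFW, hcomp.eventually_ne hL] with z hz hne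
  simp only [Function.comp_apply, Pi.div_apply, slope_def_field, hz, hx] at hne ⊢
  have hnum : G z - G x ≠ 0 := fun h => hne (by simp [h])
  have hden : W z - W x ≠ 0 := fun h => hne (by simp [h])
  by_cases hzx : z - x = 0
  · simp [hzx]
  · field_simp

/-- The one-dimensional monotone (Wasserstein-optimal) transport `W = F_ν⁻¹ ∘ F_μ` from a
continuous positive density on `[0,1]` to a density `f_ν` with a jump discontinuity at `a`
(one-sided limits `L⁻ ≠ L⁺`, both finite and positive) has one-sided derivatives
`f_μ(x₀)/L⁻` and `f_μ(x₀)/L⁺` at the point `x₀` with `W(x₀) = a`, and hence fails to be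
differentiable at `x₀`. -/
theorem optimal_transport_not_C1_at_jump
    (fμ : ℝ → ℝ)
    (hfμc : ContinuousOn fμ (Icc (0:ℝ) 1))
    (hfμpos : ∀ x ∈ Icc (0:ℝ) 1, 0 < fμ x)
    (hfμ0 : ∀ x ∉ Icc (0:ℝ) 1, fμ x = 0)
    (hfμi : Integrable fμ) (hfμ1 : ∫ x, fμ x = 1)
    (a₀ c₀ a : ℝ) (ha : a ∈ Ioo a₀ c₀)
    (fν : ℝ → ℝ)
    (hfν0 : ∀ y ∉ Icc a₀ c₀, fν y = 0)
    (hfνnn : ∀ y, 0 ≤ fν y)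
    (hfνpos : ∀ y ∈ Ioo a₀ c₀, 0 < fν y)
    (hfνc : ContinuousOn fν (Ioo a₀ c₀ \ {a}))
    (hfνi : Integrable fν) (hfν1 : ∫ y, fν y = 1)
    (Lm Lp : ℝ)
    (hLm : Tendsto fν (nhdsWithin a (Iio a)) (nhds Lm))
    (hLp : Tendsto fν (nhdsWithin a (Ioi a)) (nhds Lp))
    (hLmpos : 0 < Lm) (hLppos : 0 < Lp) (hLne : Lm ≠ Lp)
    (Fμ Fν : ℝ → ℝ)
    (hFμ : ∀ x, Fμ x = ∫ t in Iic x, fμ t)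
    (hFν : ∀ y, Fν y = ∫ t in Iic y, fν t)
    (W : ℝ → ℝ)
    (hW : ∀ x, W x = sInf {y : ℝ | Fν y ≥ Fμ x})
    (x₀ : ℝ) (hx₀ : x₀ ∈ Ioo (0:ℝ) 1) (hWx₀ : W x₀ = a) :
    HasDerivWithinAt W (fμ x₀ / Lm) (Iio x₀) x₀ ∧
    HasDerivWithinAt W (fμ x₀ / Lp) (Ioi x₀) x₀ ∧
    fμ x₀ / Lm ≠ fμ x₀ / Lp ∧
    ¬ DifferentiableAt ℝ W x₀ := by
  have hfμnn : ∀ x, 0 ≤ fμ x := fun x => by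
    by_cases hx : x ∈ Icc (0:ℝ) 1
    · exact (hfμpos x hx).le
    · exact (hfμ0 x hx).ge
  have hμstrict := strictMonoOn_cdf hfμi (fun x hx => hfμpos x (Ioo_subset_Icc_self hx)) hFμ
  have hνstrict := strictMonoOn_cdf hfνi hfνpos hFν
  have hνmono := monotone_cdf hfνi hfνnn hFν
  have hμcont := continuous_cdf hfμi hFμ
  have hνcont := continuous_cdf hfνi hFν
  have hWspec : ∀ x ∈ Ioo (0:ℝ) 1, W x ∈ Ioo a₀ c₀ ∧ Fν (W x) = Fμ x := fun x hx => by
    rw [hW]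
    refine quantile_mem_Ioo_and_eq (ha.1.trans ha.2).le hνcont hνmono hνstrict ?_
    rw [cdf_eq_zero hfν0 hFν, cdf_eq_one hfν0 hfν1 hFν, ← cdf_eq_zero hfμ0 hFμ,
      ← cdf_eq_one hfμ0 hfμ1 hFμ]
    exact ⟨hμstrict (by simp) (Ioo_subset_Icc_self hx) hx.1,
      hμstrict (Ioo_subset_Icc_self hx) (by simp) hx.2⟩
  have hWmono : StrictMonoOn W (Ioo 0 1) := fun x hx y hy hxy => by
    refine hνmono.reflect_lt ?_
    rw [(hWspec x hx).2, (hWspec y hy).2]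
    exact hμstrict (Ioo_subset_Icc_self hx) (Ioo_subset_Icc_self hy) hxy
  have hnear : ∀ᶠ x in 𝓝 x₀, x ∈ Ioo (0:ℝ) 1 := isOpen_Ioo.mem_nhds hx₀
  have hFa : Fν a = Fμ x₀ := hWx₀ ▸ (hWspec x₀ hx₀).2
  have hWcont : Tendsto W (𝓝 x₀) (𝓝 (W x₀)) := by
    rw [hWx₀, tendsto_order]
    constructor
    · intro b hb
      have hb' : max b a₀ < a := max_lt hb ha.1
      have hlt := hνstrict ⟨le_max_right b a₀, hb'.le.trans ha.2.le⟩ (Ioo_subset_Icc_self ha) hb'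
      rw [hFa] at hlt
      filter_upwards [hnear, hμcont.continuousAt.eventually_const_lt hlt] with x hx hlt
      rw [← (hWspec x hx).2] at hlt
      exact (le_max_left b a₀).trans_lt (hνmono.reflect_lt hlt)
    · intro b hb
      have hb' : a < min b c₀ := lt_min hb ha.2
      have hlt := hνstrict (Ioo_subset_Icc_self ha) ⟨ha.1.le.trans hb'.le, min_le_right b c₀⟩ hb'
      rw [hFa] at hlt
      filter_upwards [hnear, hμcont.continuousAt.eventually_lt_const hlt] with x hx hlt
      rw [← (hWspec x hx).2] at hlt
      exact (hνmono.reflect_lt hlt).trans_le (min_le_left b c₀)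
  have hfμx₀ : Tendsto fμ (𝓝 x₀) (𝓝 (fμ x₀)) := hfμc.continuousAt (Icc_mem_nhds hx₀.1 hx₀.2)
  have hFW : ∀ᶠ x in 𝓝 x₀, Fν (W x) = Fμ x := hnear.mono fun x hx => (hWspec x hx).2
  have hleft : HasDerivWithinAt W (fμ x₀ / Lm) (Iio x₀) x₀ := by
    refine (hasDerivWithinAt_Iio_cdf hfμi hFμ
      (hfμx₀.mono_left nhdsWithin_le_nhds)).div_of_comp_eventuallyEq (t := Iio (W x₀))
      (hWx₀ ▸ hasDerivWithinAt_Iio_cdf hfνi hFν hLm) hLmpos.ne'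
      (tendsto_nhdsWithin_iff.2 ⟨hWcont.mono_left nhdsWithin_le_nhds, ?_⟩)
      self_notMem_Iio self_notMem_Iio hFW.self_of_nhds (nhdsWithin_le_nhds hFW)
    filter_upwards [nhdsWithin_le_nhds hnear, self_mem_nhdsWithin] with x hx hlt
    exact hWmono hx hx₀ hlt
  have hright : HasDerivWithinAt W (fμ x₀ / Lp) (Ioi x₀) x₀ := by
    refine (hasDerivWithinAt_Ioi_cdf hfμi hFμ
      (hfμx₀.mono_left nhdsWithin_le_nhds)).div_of_comp_eventuallyEq (t := Ioi (W x₀))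
      (hWx₀ ▸ hasDerivWithinAt_Ioi_cdf hfνi hFν hLp) hLppos.ne'
      (tendsto_nhdsWithin_iff.2 ⟨hWcont.mono_left nhdsWithin_le_nhds, ?_⟩)
      self_notMem_Ioi self_notMem_Ioi hFW.self_of_nhds (nhdsWithin_le_nhds hFW)
    filter_upwards [nhdsWithin_le_nhds hnear, self_mem_nhdsWithin] with x hx hlt
    exact hWmono hx₀ hx hlt
  have hne : fμ x₀ / Lm ≠ fμ x₀ / Lp := fun h => hLne <| by
    rw [div_eq_mul_inv, div_eq_mul_inv] at h
    exact inv_injective (mul_left_cancel₀ (hfμpos x₀ (Ioo_subset_Icc_self hx₀)).ne' h)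
  refine ⟨hleft, hright, hne, fun hd => hne ?_⟩
  have hd := hd.hasDerivAt
  exact ((uniqueDiffWithinAt_Iio x₀).eq_deriv _ hleft hd.hasDerivWithinAt).trans
    ((uniqueDiffWithinAt_Ioi x₀).eq_deriv _ hd.hasDerivWithinAt hright)
end

section
/- Let T(x) = −(3/2 + √2)x² + (2 + √2)x, let λ₀ denote Lebesgue measure restricted to [0,1], and let ν = T♯λ₀. Then every nondecreasing Borel map W : [0,1] → ℝ with W♯λ₀ = ν satisfies ∫₀¹ (x − W(x))² dx = (41√2 − 54)/60. In particular, the Wasserstein-optimal transport cost from λ₀ to ν is (41√2 − 54)/60, which is strictly smaller than the cost (6 + √2)/60 of the folded map T itself. -/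
open MeasureTheory Set

/-- The increasing rearrangement on `[0,1]` of the folded quadratic map with coefficients in `s`,
where `s` plays the role of `√2`. -/
noncomputable def foldedQuantile (s x : ℝ) : ℝ :=
  if x ≤ 3 - 2 * s then -(3/2 + s) * x ^ 2 + (2 + s) * x else 1 - (3/2 + s) / 4 * (1 - x) ^ 2

theorem continuous_foldedQuantile {s : ℝ} (hs : s ^ 2 = 2) : Continuous (foldedQuantile s) := by
  unfold foldedQuantile
  refine Continuous.if_le (by fun_prop) (by fun_prop) continuous_id continuous_const ?_
  intro x hx
  have hx' : x = 3 - 2 * s := hx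
  subst hx'
  linear_combination (-3 * s + 7/2) * hs

/-- A function that is nondecreasing on `[0,1]` agrees on `(0,1)` with any continuous function `G`
such that the image measure of `W` gives mass `x` to `(-∞, G x)`. -/
theorem MonotoneOn.eq_of_map_restrict_Iio {W G : ℝ → ℝ} (hW : MonotoneOn W (Icc (0:ℝ) 1))
    (hWm : Measurable W) (hG : Continuous G)
    (h : ∀ x ∈ Ioo (0:ℝ) 1,
      Measure.map W (volume.restrict (Icc (0:ℝ) 1)) (Iio (G x)) = ENNReal.ofReal x)
    {x : ℝ} (hx : x ∈ Ioo (0:ℝ) 1) : W x = G x := by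
  have hxI : x ∈ Icc (0:ℝ) 1 := Ioo_subset_Icc_self hx
  rcases lt_trichotomy (W x) (G x) with hlt | heq | hgt
  · exfalso
    have hev : ∀ᶠ y in nhdsWithin x (Iio x), W x < G y ∧ y ∈ Ioo 0 x :=
      ((hG.continuousAt.eventually (lt_mem_nhds hlt)).filter_mono nhdsWithin_le_nhds).and
        (Ioo_mem_nhdsLT hx.1)
    obtain ⟨y, hy, hy0, hyx⟩ := hev.exists
    have hm := h y ⟨hy0, hyx.trans hx.2⟩
    rw [Measure.map_apply hWm measurableSet_Iio,
      Measure.restrict_apply (hWm measurableSet_Iio)] at hm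
    have hsub : Icc 0 x ⊆ W ⁻¹' Iio (G y) ∩ Icc (0:ℝ) 1 := fun t ht =>
      ⟨(hW ⟨ht.1, ht.2.trans hxI.2⟩ hxI ht.2).trans_lt hy, ht.1, ht.2.trans hxI.2⟩
    have hle := measure_mono (μ := volume) hsub
    rw [hm, Real.volume_Icc, ENNReal.ofReal_le_ofReal_iff hy0.le] at hle
    linarith
  · exact heq
  · exfalso
    have hev : ∀ᶠ y in nhdsWithin x (Ioi x), G y < W x ∧ y ∈ Ioo x 1 :=
      ((hG.continuousAt.eventually (gt_mem_nhds hgt)).filter_mono nhdsWithin_le_nhds).and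
        (Ioo_mem_nhdsGT hx.2)
    obtain ⟨y, hy, hxy, hy1⟩ := hev.exists
    have hm := h y ⟨hx.1.trans hxy, hy1⟩
    rw [Measure.map_apply hWm measurableSet_Iio,
      Measure.restrict_apply (hWm measurableSet_Iio)] at hm
    have hsub : W ⁻¹' Iio (G y) ∩ Icc (0:ℝ) 1 ⊆ Icc 0 x := by
      rintro t ⟨ht, htI⟩
      refine ⟨htI.1, le_of_not_gt fun hxt => ?_⟩
      have h1 := hW hxI htI hxt.le
      have h2 : W t < G y := ht
      linarith
    have hle := measure_mono (μ := volume) hsub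
    rw [hm, Real.volume_Icc, ENNReal.ofReal_le_ofReal_iff (by linarith [hx.1])] at hle
    linarith

theorem volume_folded_lt_foldedQuantile {s x : ℝ} (hs : s ^ 2 = 2) (hs1 : 1 < s)
    (hs2 : s < 3/2) (hx : x ∈ Ioo (0:ℝ) 1) :
    volume ({t : ℝ | -(3/2 + s) * t ^ 2 + (2 + s) * t < foldedQuantile s x} ∩ Icc (0:ℝ) 1)
      = ENNReal.ofReal x := by
  obtain ⟨hx0, hx1⟩ := hx
  unfold foldedQuantile
  split_ifs with hxs
  · have hset : {t : ℝ | -(3/2 + s) * t ^ 2 + (2 + s) * t < -(3/2 + s) * x ^ 2 + (2 + s) * x}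
        ∩ Icc (0:ℝ) 1 = Ico 0 x := by
      ext t
      have hfac : (-(3/2 + s) * x ^ 2 + (2 + s) * x) - (-(3/2 + s) * t ^ 2 + (2 + s) * t)
          = (3/2 + s) * ((x - t) * (4 - 2 * s - x - t)) := by
        linear_combination (2 * (x - t)) * hs
      have hpos : 0 < 3/2 + s := by linarith
      simp only [mem_inter_iff, mem_ofPred_eq, mem_Icc, mem_Ico]
      constructor
      · rintro ⟨h, h0, h1⟩
        refine ⟨h0, lt_of_not_ge fun hxt => ?_⟩
        have : (x - t) * (4 - 2 * s - x - t) ≤ 0 :=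
          mul_nonpos_of_nonpos_of_nonneg (by linarith) (by linarith)
        nlinarith
      · rintro ⟨h0, h1⟩
        have : 0 < (x - t) * (4 - 2 * s - x - t) := mul_pos (by linarith) (by nlinarith)
        exact ⟨by nlinarith, h0, by linarith⟩
    rw [hset, Real.volume_Ico, sub_zero]
  · push Not at hxs
    have hset : {t : ℝ | -(3/2 + s) * t ^ 2 + (2 + s) * t < 1 - (3/2 + s) / 4 * (1 - x) ^ 2}
        ∩ Icc (0:ℝ) 1 = Ico 0 (2 - s - (1 - x) / 2) ∪ Ioc (2 - s + (1 - x) / 2) 1 := by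
      ext t
      have hfac : (1 - (3/2 + s) / 4 * (1 - x) ^ 2) - (-(3/2 + s) * t ^ 2 + (2 + s) * t)
          = (3/2 + s) * ((2 - s - (1 - x) / 2 - t) * (2 - s + (1 - x) / 2 - t)) := by
        linear_combination (5/2 - s - 2 * t) * hs
      have hpos : 0 < 3/2 + s := by linarith
      simp only [mem_inter_iff, mem_ofPred_eq, mem_Icc, mem_union, mem_Ico, mem_Ioc]
      constructor
      · rintro ⟨h, h0, h1⟩
        by_contra! hcon
        have hlo : 2 - s - (1 - x) / 2 ≤ t := hcon.1 h0
        have hhi : t ≤ 2 - s + (1 - x) / 2 := by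
          by_contra! hlt
          linarith [hcon.2 hlt]
        have : (2 - s - (1 - x) / 2 - t) * (2 - s + (1 - x) / 2 - t) ≤ 0 :=
          mul_nonpos_of_nonpos_of_nonneg (by linarith) (by linarith)
        nlinarith
      · rintro (⟨h0, h1⟩ | ⟨h0, h1⟩)
        · have : 0 < (2 - s - (1 - x) / 2 - t) * (2 - s + (1 - x) / 2 - t) :=
            mul_pos (by linarith) (by linarith)
          exact ⟨by nlinarith, h0, by linarith⟩
        · have : 0 < (2 - s - (1 - x) / 2 - t) * (2 - s + (1 - x) / 2 - t) :=
            mul_pos_of_neg_of_neg (by linarith) (by linarith)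
          exact ⟨by nlinarith, by linarith, h1⟩
    have hdisj : Disjoint (Ico 0 (2 - s - (1 - x) / 2)) (Ioc (2 - s + (1 - x) / 2) 1) := by
      rw [Set.disjoint_left]
      rintro t ⟨_, h1⟩ ⟨h2, _⟩
      linarith
    rw [hset, measure_union hdisj measurableSet_Ioc, Real.volume_Ico, Real.volume_Ioc,
      ← ENNReal.ofReal_add (by linarith) (by linarith)]
    congr 1
    ring

theorem integral_quadratic_sq (p q r a b : ℝ) :
    ∫ x in a..b, (p + q * x + r * x ^ 2) ^ 2 =
      (p ^ 2 * b + p * q * b ^ 2 + (q ^ 2 + 2 * p * r) / 3 * b ^ 3 + q * r / 2 * b ^ 4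
        + r ^ 2 / 5 * b ^ 5) -
      (p ^ 2 * a + p * q * a ^ 2 + (q ^ 2 + 2 * p * r) / 3 * a ^ 3 + q * r / 2 * a ^ 4
        + r ^ 2 / 5 * a ^ 5) := by
  refine intervalIntegral.integral_eq_sub_of_hasDerivAt
    (f := fun x => p ^ 2 * x + p * q * x ^ 2 + (q ^ 2 + 2 * p * r) / 3 * x ^ 3
      + q * r / 2 * x ^ 4 + r ^ 2 / 5 * x ^ 5) (fun x _ => ?_)
    (Continuous.intervalIntegrable (by fun_prop) _ _)
  refine HasDerivAt.congr_deriv ((((((hasDerivAt_id' x).const_mul (p ^ 2)).add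
    ((hasDerivAt_pow 2 x).const_mul (p * q))).add
    ((hasDerivAt_pow 3 x).const_mul ((q ^ 2 + 2 * p * r) / 3))).add
    ((hasDerivAt_pow 4 x).const_mul (q * r / 2))).add
    ((hasDerivAt_pow 5 x).const_mul (r ^ 2 / 5))) ?_
  norm_num
  ring

theorem integral_sub_foldedQuantile_sq {s : ℝ} (hs : s ^ 2 = 2) (hs1 : 1 < s) (hs2 : s < 3/2) :
    ∫ x in (0:ℝ)..1, (x - foldedQuantile s x) ^ 2 = (41 * s - 54) / 60 := by
  have hcont : Continuous fun x => (x - foldedQuantile s x) ^ 2 :=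
    (continuous_id.sub (continuous_foldedQuantile hs)).pow 2
  have hleft : ∫ x in (0:ℝ)..(3 - 2 * s), (x - foldedQuantile s x) ^ 2
      = ∫ x in (0:ℝ)..(3 - 2 * s), (0 + -(1 + s) * x + (3/2 + s) * x ^ 2) ^ 2 := by
    refine intervalIntegral.integral_congr fun x hx => ?_
    rw [uIcc_of_le (by linarith)] at hx
    simp only [foldedQuantile, if_pos hx.2]
    ring
  have hright : ∫ x in (3 - 2 * s)..(1:ℝ), (x - foldedQuantile s x) ^ 2
      = ∫ x in (3 - 2 * s)..(1:ℝ), (((3/2 + s) / 4 - 1) + (1 - 2 * ((3/2 + s) / 4)) * x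
          + (3/2 + s) / 4 * x ^ 2) ^ 2 := by
    refine intervalIntegral.integral_congr_ae (Filter.Eventually.of_forall fun x hx => ?_)
    rw [uIoc_of_le (by linarith)] at hx
    simp only [foldedQuantile, if_neg (not_le.mpr hx.1)]
    ring
  rw [← intervalIntegral.integral_add_adjacent_intervals
    (hcont.intervalIntegrable 0 (3 - 2 * s)) (hcont.intervalIntegrable (3 - 2 * s) 1),
    hleft, hright, integral_quadratic_sq, integral_quadratic_sq]
  have h3 : s ^ 3 = 2 * s := by linear_combination s * hs
  have h4 : s ^ 4 = 4 := by linear_combination (s ^ 2 + 2) * hs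
  have h5 : s ^ 5 = 4 * s := by linear_combination s * h4
  have h6 : s ^ 6 = 8 := by linear_combination s ^ 2 * h4 + 4 * hs
  have h7 : s ^ 7 = 8 * s := by linear_combination s * h6
  ring_nf
  rw [h7, h6, h5, h4, h3, hs]
  ring

/-- Every nondecreasing (hence Wasserstein-optimal) transport pushing the uniform measure
on `[0,1]` to the pushforward of the folded quadratic map
`T(x) = −(3/2 + √2)x² + (2 + √2)x` has quadratic cost `(41√2 − 54)/60`, which is strictly
smaller than the cost `(6 + √2)/60` of the folded map `T` itself. -/
theorem wasserstein_cost_of_folded_quadratic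
    (T : ℝ → ℝ)
    (hT : ∀ x, T x = -(3/2 + Real.sqrt 2) * x ^ 2 + (2 + Real.sqrt 2) * x)
    (lam₀ ν : Measure ℝ)
    (hlam₀ : lam₀ = volume.restrict (Icc (0:ℝ) 1))
    (hν : ν = Measure.map T lam₀) :
    (∀ W : ℝ → ℝ, MonotoneOn W (Icc (0:ℝ) 1) → Measurable W →
        Measure.map W lam₀ = ν →
        ∫ x in (0:ℝ)..1, (x - W x) ^ 2 = (41 * Real.sqrt 2 - 54) / 60) ∧
    (41 * Real.sqrt 2 - 54) / 60 < (6 + Real.sqrt 2) / 60 := by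
  have hs : Real.sqrt 2 ^ 2 = 2 := Real.sq_sqrt (by norm_num)
  have hs0 := Real.sqrt_nonneg 2
  have hs1 : 1 < Real.sqrt 2 := by nlinarith
  have hs2 : Real.sqrt 2 < 3/2 := by nlinarith
  refine ⟨fun W hW hWm hmap => ?_, by linarith⟩
  have hTm : Measurable T := by
    rw [funext hT]
    fun_prop
  subst hlam₀ hν
  have hEq : ∀ x ∈ Ioo (0:ℝ) 1, W x = foldedQuantile (Real.sqrt 2) x := fun x hx =>
    hW.eq_of_map_restrict_Iio hWm (continuous_foldedQuantile hs) (fun y hy => by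
      rw [hmap, Measure.map_apply hTm measurableSet_Iio,
        Measure.restrict_apply (hTm measurableSet_Iio),
        ← volume_folded_lt_foldedQuantile hs hs1 hs2 hy, funext hT]
      rfl) hx
  rw [← integral_sub_foldedQuantile_sq hs hs1 hs2]
  refine intervalIntegral.integral_congr_ae ?_
  filter_upwards [compl_mem_ae_iff.mpr (measure_singleton (1:ℝ))] with x hx1 hx
  rw [uIoc_of_le zero_le_one] at hx
  rw [hEq x ⟨hx.1, lt_of_le_of_ne hx.2 hx1⟩]
end

section
/- Let b < c, let ρ₂ : [b,c] → ℝ be continuous with ρ₂ > 0 on [b,c), and set F(y) = ∫_b^y ρ₂ dλ. Let β ∈ ℝ, δ = β + F(c), and γ ∈ (β, δ). Define T₂(x) = F⁻¹( F(c)(x − β)/(γ − β) ) for x ∈ [β, γ] and T₃(x) = F⁻¹( F(c)(x − β − F(c))/(γ − β − F(c)) ) for x ∈ [γ, δ]. Then T₂ is a strictly increasing continuous bijection from [β,γ] onto [b,c] with T₂(β) = b and T₂(γ) = c; T₃ is a strictly decreasing continuous bijection from [γ,δ] onto [b,c] with T₃(γ) = c and T₃(δ) = b; and the piecewise map T equal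 to T₂ on [β,γ] and to T₃ on (γ,δ] pushes Lebesgue measure restricted to [β,δ] forward to the measure ρ₂·λ on [b,c]. -/
open MeasureTheory Set

/-- Preimages under the inverse of a bijection `f : s → t` are images under `f`. -/
theorem preimage_inter_eq_image_of_invOn {α β : Type*} {f : α → β} {g : β → α} {s : Set α}
    {t : Set β} (hgf : InvOn g f s t) (hf : MapsTo f s t) (hg : MapsTo g t s) (u : Set α) :
    g ⁻¹' u ∩ t = f '' (u ∩ s) := by
  ext y
  constructor
  · rintro ⟨hyu, hyt⟩
    exact ⟨g y, ⟨hyu, hg hyt⟩, hgf.2 hyt⟩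
  · rintro ⟨x, ⟨hxu, hxs⟩, rfl⟩
    exact ⟨by rwa [mem_preimage, hgf.1 hxs], hf hxs⟩

/-- The inverse of a continuous bijection from a compact set is continuous. -/
theorem ContinuousOn.continuousOn_of_invOn {α β : Type*} [TopologicalSpace α]
    [TopologicalSpace β] [T2Space β] {f : α → β} {g : β → α} {s : Set α}
    {t : Set β} (hfc : ContinuousOn f s) (hs : IsCompact s)
    (hgf : InvOn g f s t) (hf : MapsTo f s t) (hg : MapsTo g t s) : ContinuousOn g t := by
  refine continuousOn_iff_isClosed.2 fun u hu => ⟨f '' (u ∩ s), ?_, ?_⟩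
  · exact ((hs.inter_left hu).image_of_continuousOn (hfc.mono inter_subset_right)).isClosed
  · rw [← preimage_inter_eq_image_of_invOn hgf hf hg, inter_assoc, inter_self]

/-- The inverse of a strictly increasing function is strictly increasing. -/
theorem StrictMonoOn.strictMonoOn_of_rightInvOn {α β : Type*} [LinearOrder α] [LinearOrder β]
    {f : α → β} {g : β → α} {s : Set α} {t : Set β} (hfm : StrictMonoOn f s)
    (hgf : RightInvOn g f t) (hg : MapsTo g t s) : StrictMonoOn g t := by
  intro x hx y hy hxy
  rw [← hfm.lt_iff_lt (hg hx) (hg hy), hgf hx, hgf hy]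
  exact hxy

/-- If `f : s → t` is a differentiable bijection, its inverse pushes Lebesgue measure on `t`
forward to the measure on `s` with density `|f'|`. -/
theorem map_restrict_of_invOn {f f' g : ℝ → ℝ} {s t : Set ℝ} (hs : MeasurableSet s)
    (ht : MeasurableSet t) (hd : ∀ x ∈ s, HasDerivWithinAt f (f' x) s x)
    (hgf : InvOn g f s t) (hf : MapsTo f s t) (hg : MapsTo g t s)
    (hgm : AEMeasurable g (volume.restrict t)) :
    Measure.map g (volume.restrict t)
      = (volume.restrict s).withDensity (fun x => ENNReal.ofReal |f' x|) := by
  ext u hu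
  rw [Measure.map_apply_of_aemeasurable hgm hu, Measure.restrict_apply' ht,
    preimage_inter_eq_image_of_invOn hgf hf hg, withDensity_apply _ hu,
    Measure.restrict_restrict hu]
  have h := lintegral_image_eq_lintegral_abs_deriv_mul (hu.inter hs)
    (fun x hx => (hd x hx.2).mono inter_subset_right)
    (hgf.1.injOn.mono inter_subset_right) (fun _ => 1)
  simpa using h

/-- A nondegenerate affine map rescales Lebesgue measure. -/
theorem map_affine_restrict_preimage {k : ℝ} (hk : k ≠ 0) (a : ℝ) {t : Set ℝ}
    (ht : MeasurableSet t) :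
    Measure.map (fun x => k * (x - a)) (volume.restrict ((fun x => k * (x - a)) ⁻¹' t))
      = ENNReal.ofReal |k⁻¹| • volume.restrict t := by
  have hm : Measurable fun x : ℝ => k * (x - a) := by fun_prop
  have h : Measure.map (fun x : ℝ => k * (x - a)) volume = ENNReal.ofReal |k⁻¹| • volume := by
    rw [← Real.map_volume_mul_left hk]
    conv_rhs => rw [← map_sub_right_eq_self (volume : Measure ℝ) a]
    rw [Measure.map_map (by fun_prop) (by fun_prop)]
    rfl
  rw [← Measure.restrict_map hm ht, h, Measure.restrict_smul]

/-- Precomposing with an affine map that carries `s` onto `t` rescales the pushforward of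
Lebesgue measure. -/
theorem map_comp_affine_restrict {g : ℝ → ℝ} {k : ℝ} (hk : k ≠ 0) (a : ℝ) {s t : Set ℝ}
    (ht : MeasurableSet t) (hst : (fun x => k * (x - a)) ⁻¹' t = s)
    (hg : AEMeasurable g (volume.restrict t)) :
    Measure.map (fun x => g (k * (x - a))) (volume.restrict s)
      = ENNReal.ofReal |k⁻¹| • Measure.map g (volume.restrict t) := by
  have hmap := map_affine_restrict_preimage hk a ht
  rw [hst] at hmap
  rw [← Measure.map_smul, ← hmap, AEMeasurable.map_map_of_aemeasurable _ (by fun_prop)]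
  · rfl
  · rw [hmap]
    exact hg.smul_measure _

/-- The primitive of a continuous function on `[b, c]` has it as derivative within `[b, c]`. -/
theorem hasDerivWithinAt_primitive_Icc {f : ℝ → ℝ} {b c : ℝ} (hbc : b ≤ c)
    (hf : ContinuousOn f (Icc b c)) {x : ℝ} (hx : x ∈ Icc b c) :
    HasDerivWithinAt (fun y => ∫ t in b..y, f t) (f x) (Icc b c) x := by
  have hg : Continuous (IccExtend hbc ((Icc b c).domRestrict f)) :=
    hf.domRestrict.Icc_extend'
  have heq : ∀ y ∈ Icc b c, IccExtend hbc ((Icc b c).domRestrict f) y = f y := fun y hy => by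
    rw [IccExtend_of_mem _ _ hy, domRestrict_apply]
  have hprim : ∀ y ∈ Icc b c,
      ∫ t in b..y, f t = ∫ t in b..y, IccExtend hbc ((Icc b c).domRestrict f) t := by
    intro y hy
    refine intervalIntegral.integral_congr fun t ht => ?_
    rw [uIcc_of_le hy.1] at ht
    exact (heq t ⟨ht.1, ht.2.trans hy.2⟩).symm
  have h := (hg.integral_hasStrictDerivAt b x).hasDerivAt.hasDerivWithinAt (s := Icc b c)
  rw [heq x hx] at h
  exact h.congr hprim (hprim x hx)

/-- The tent-shaped (fold) transport onto a prescribed density `ρ₂` on `[b,c]`: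
the increasing branch `T₂` maps `[β,γ]` onto `[b,c]`, the decreasing branch `T₃`
maps `[γ,δ]` onto `[b,c]`, and the piecewise map pushes Lebesgue measure on `[β,δ]`
forward to `ρ₂·λ` on `[b,c]`. -/
theorem tent_transport_pushforward
    (b c : ℝ) (hbc : b < c)
    (ρ₂ : ℝ → ℝ)
    (hρc : ContinuousOn ρ₂ (Icc b c))
    (hρpos : ∀ y ∈ Ico b c, 0 < ρ₂ y)
    (F : ℝ → ℝ) (hF : ∀ y, F y = ∫ t in b..y, ρ₂ t)
    (β δ γ : ℝ) (hδ : δ = β + F c) (hγ : γ ∈ Ioo β δ)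
    (Finv : ℝ → ℝ)
    (hFinv₁ : ∀ y ∈ Icc b c, Finv (F y) = y)
    (hFinv₂ : ∀ u ∈ Icc 0 (F c), Finv u ∈ Icc b c ∧ F (Finv u) = u)
    (T₂ T₃ T : ℝ → ℝ)
    (hT₂ : ∀ x, T₂ x = Finv (F c * (x - β) / (γ - β)))
    (hT₃ : ∀ x, T₃ x = Finv (F c * (x - β - F c) / (γ - β - F c)))
    (hT : ∀ x, T x = if x ≤ γ then T₂ x else T₃ x) :
    StrictMonoOn T₂ (Icc β γ) ∧ ContinuousOn T₂ (Icc β γ) ∧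
    T₂ '' Icc β γ = Icc b c ∧ T₂ β = b ∧ T₂ γ = c ∧
    StrictAntiOn T₃ (Icc γ δ) ∧ ContinuousOn T₃ (Icc γ δ) ∧
    T₃ '' Icc γ δ = Icc b c ∧ T₃ γ = c ∧ T₃ δ = b ∧
    Measure.map T (volume.restrict (Icc β δ))
      = (volume.restrict (Icc b c)).withDensity (fun y => ENNReal.ofReal (ρ₂ y)) := by
  obtain ⟨hβγ, hγδ⟩ := hγ
  have hFd : ∀ x ∈ Icc b c, HasDerivWithinAt F (ρ₂ x) (Icc b c) x := fun x hx => by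
    rw [funext hF]
    exact hasDerivWithinAt_primitive_Icc hbc.le hρc hx
  have hFcont : ContinuousOn F (Icc b c) := fun x hx => (hFd x hx).continuousWithinAt
  have hFb : F b = 0 := by simp [hF]
  have hbmem : b ∈ Icc b c := left_mem_Icc.2 hbc.le
  have hcmem : c ∈ Icc b c := right_mem_Icc.2 hbc.le
  have hFmono : StrictMonoOn F (Icc b c) := by
    refine strictMonoOn_of_deriv_pos (convex_Icc b c) hFcont fun x hx => ?_
    rw [interior_Icc] at hx
    rw [((hFd x (Ioo_subset_Icc_self hx)).hasDerivAt (Icc_mem_nhds hx.1 hx.2)).deriv]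
    exact hρpos x ⟨hx.1.le, hx.2⟩
  have hM : 0 < F c := hFb ▸ hFmono hbmem hcmem hbc
  have hmapsF : MapsTo F (Icc b c) (Icc 0 (F c)) := fun x hx =>
    ⟨hFb ▸ hFmono.monotoneOn hbmem hx hx.1, hFmono.monotoneOn hx hcmem hx.2⟩
  have hmapsInv : MapsTo Finv (Icc 0 (F c)) (Icc b c) := fun u hu => (hFinv₂ u hu).1
  have hinv : InvOn Finv F (Icc b c) (Icc 0 (F c)) := ⟨hFinv₁, fun u hu => (hFinv₂ u hu).2⟩
  have hInvCont := hFcont.continuousOn_of_invOn isCompact_Icc hinv hmapsF hmapsInv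
  have hInvMono := hFmono.strictMonoOn_of_rightInvOn hinv.2 hmapsInv
  have hInvSurj : SurjOn Finv (Icc 0 (F c)) (Icc b c) := hinv.1.surjOn hmapsF
  have hInvMeas : AEMeasurable Finv (volume.restrict (Icc 0 (F c))) :=
    hInvCont.aemeasurable measurableSet_Icc
  have hInv0 : Finv 0 = b := hFb ▸ hFinv₁ b hbmem
  have hInvM : Finv (F c) = c := hFinv₁ c hcmem
  set ν := (volume.restrict (Icc b c)).withDensity (fun y => ENNReal.ofReal (ρ₂ y)) with hν
  have hmap : Measure.map Finv (volume.restrict (Icc 0 (F c))) = ν := by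
    rw [map_restrict_of_invOn measurableSet_Icc measurableSet_Icc hFd hinv hmapsF hmapsInv
      hInvMeas, hν]
    refine withDensity_congr_ae ?_
    rw [← restrict_Ico_eq_restrict_Icc]
    filter_upwards [ae_restrict_mem measurableSet_Ico] with y hy
    rw [abs_of_pos (hρpos y hy)]
  -- The slopes of the two affine reparametrizations.
  obtain ⟨p, hp⟩ : ∃ p, p = F c / (γ - β) := ⟨_, rfl⟩
  obtain ⟨q, hq⟩ : ∃ q, q = F c / (γ - δ) := ⟨_, rfl⟩
  have hp0 : 0 < p := hp ▸ div_pos hM (sub_pos.2 hβγ)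
  have hq0 : q < 0 := hq ▸ div_neg_of_pos_of_neg hM (sub_neg.2 hγδ)
  have hpM : p * (γ - β) = F c := by rw [hp, div_mul_cancel₀ _ (sub_pos.2 hβγ).ne']
  have hqM : q * (γ - δ) = F c := by rw [hq, div_mul_cancel₀ _ (sub_neg.2 hγδ).ne]
  have hT₂' : T₂ = fun x => Finv (p * (x - β)) := by
    funext x
    rw [hT₂, hp, div_mul_eq_mul_div]
  have hT₃' : T₃ = fun x => Finv (q * (x - δ)) := by
    funext x
    rw [hT₃, hq, div_mul_eq_mul_div, hδ, sub_sub, sub_sub]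
  have hpre₂ : (fun x => p * (x - β)) ⁻¹' Icc 0 (F c) = Icc β γ := by
    ext x
    rw [mem_preimage, mem_Icc, mem_Icc, mul_nonneg_iff_of_pos_left hp0, ← hpM,
      mul_le_mul_iff_right₀ hp0, sub_nonneg, sub_le_sub_iff_right]
  have hpre₃ : (fun x => q * (x - δ)) ⁻¹' Icc 0 (F c) = Icc γ δ := by
    ext x
    rw [mem_preimage, mem_Icc, mem_Icc, ← mul_zero q, ← hqM, mul_le_mul_left_of_neg hq0,
      mul_le_mul_left_of_neg hq0, sub_nonpos, sub_le_sub_iff_right, and_comm]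
  have hmaps₂ : MapsTo (fun x => p * (x - β)) (Icc β γ) (Icc 0 (F c)) := hpre₂.ge
  have hmaps₃ : MapsTo (fun x => q * (x - δ)) (Icc γ δ) (Icc 0 (F c)) := hpre₃.ge
  have hsurj₂ : SurjOn (fun x => p * (x - β)) (Icc β γ) (Icc 0 (F c)) := by
    rw [← hpre₂]
    exact fun u hu => ⟨u / p + β, by simpa [mul_div_cancel₀, hp0.ne'] using hu, by
      simp [mul_div_cancel₀, hp0.ne']⟩
  have hsurj₃ : SurjOn (fun x => q * (x - δ)) (Icc γ δ) (Icc 0 (F c)) := by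
    rw [← hpre₃]
    exact fun u hu => ⟨u / q + δ, by simpa [mul_div_cancel₀, hq0.ne] using hu, by
      simp [mul_div_cancel₀, hq0.ne]⟩
  have hcont₂ : ContinuousOn T₂ (Icc β γ) := hT₂' ▸ hInvCont.comp (by fun_prop) hmaps₂
  have hcont₃ : ContinuousOn T₃ (Icc γ δ) := hT₃' ▸ hInvCont.comp (by fun_prop) hmaps₃
  have himg₂ : T₂ '' Icc β γ = Icc b c :=
    hT₂' ▸ (hInvSurj.comp hsurj₂).image_eq_of_mapsTo (hmapsInv.comp hmaps₂)
  have himg₃ : T₃ '' Icc γ δ = Icc b c :=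
    hT₃' ▸ (hInvSurj.comp hsurj₃).image_eq_of_mapsTo (hmapsInv.comp hmaps₃)
  have hmap₂ : Measure.map T₂ (volume.restrict (Icc β γ)) = ENNReal.ofReal |p⁻¹| • ν := by
    rw [hT₂', map_comp_affine_restrict hp0.ne' β measurableSet_Icc hpre₂ hInvMeas, hmap]
  have hmap₃ : Measure.map T₃ (volume.restrict (Icc γ δ)) = ENNReal.ofReal |q⁻¹| • ν := by
    rw [hT₃', map_comp_affine_restrict hq0.ne δ measurableSet_Icc hpre₃ hInvMeas, hmap]
  refine ⟨?_, hcont₂, himg₂, by simp [hT₂', hInv0], by simp [hT₂', hpM, hInvM],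
    ?_, hcont₃, himg₃, by simp [hT₃', hqM, hInvM], by simp [hT₃', hInv0], ?_⟩
  · intro x hx y hy hxy
    simp only [hT₂']
    exact hInvMono (hmaps₂ hx) (hmaps₂ hy) (mul_lt_mul_of_pos_left (by linarith) hp0)
  · intro x hx y hy hxy
    simp only [hT₃']
    exact hInvMono (hmaps₃ hy) (hmaps₃ hx) (mul_lt_mul_of_neg_left (by linarith) hq0)
  · have hae₂ : T =ᵐ[volume.restrict (Icc β γ)] T₂ := by
      filter_upwards [ae_restrict_mem measurableSet_Icc] with x hx
      rw [hT, if_pos hx.2]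
    have hae₃ : T =ᵐ[volume.restrict (Icc γ δ)] T₃ := by
      rw [← restrict_Ioc_eq_restrict_Icc]
      filter_upwards [ae_restrict_mem measurableSet_Ioc] with x hx
      rw [hT, if_neg hx.1.not_ge]
    have hm₂ := (hcont₂.aemeasurable measurableSet_Icc (μ := volume)).congr hae₂.symm
    have hm₃ := (hcont₃.aemeasurable measurableSet_Icc (μ := volume)).congr hae₃.symm
    have hsplit : (volume : Measure ℝ).restrict (Icc β δ)
        = volume.restrict (Icc β γ) + volume.restrict (Icc γ δ) := by
      rw [← restrict_Ioc_eq_restrict_Icc (a := γ), ← Icc_union_Ioc_eq_Icc hβγ.le hγδ.le]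
      refine Measure.restrict_union ?_ measurableSet_Ioc
      exact disjoint_left.2 fun x hx hx' => hx'.1.not_ge hx.2
    rw [hsplit, AEMeasurable.map_add₀ hm₂ hm₃, Measure.map_congr hae₂, Measure.map_congr hae₃,
      hmap₂, hmap₃, ← add_smul, ← ENNReal.ofReal_add (abs_nonneg _) (abs_nonneg _),
      abs_of_pos (inv_pos.2 hp0), abs_of_neg (inv_lt_zero.2 hq0), hp, hq, inv_div, inv_div]
    have hone : (γ - β) / F c + -((γ - δ) / F c) = 1 := by
      rw [hδ]
      field_simp
      ring
    rw [hone, ENNReal.ofReal_one, one_smul]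
end

section
/- Let a < b < c. Let ρ₁ : [a,b] → ℝ be continuous and strictly positive with cdf F₁(y) = ∫_a^y ρ₁ dλ, and let ρ₂ : [b,c] → ℝ be continuous with ρ₂ > 0 on [b,c) and cdf F₂(y) = ∫_b^y ρ₂ dλ. Let α ∈ ℝ, β = α + F₁(b), and γ ∈ (β, β + F₂(c)). Define T₁(x) = F₁⁻¹(x − α) on [α, β] and T₂(x) = F₂⁻¹( F₂(c)(x − β)/(γ − β) ) on [β, γ]. Then T₁ is differentiable from the left at β with T₁'(β) = 1/ρ₁(b), T₂ is differentiable from the right at β with T₂'(β) = F₂(c)/((γ − β) ρ₂(b)), and T₁'(β) = T₂'(β) if and only if γ = β + F₂(c) ρ₁(b)/ρ₂(b). -/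
open MeasureTheory Set

/-- A right inverse on `S` of a map that is continuous on a compact set `K`, with values in `K`,
which is also a left inverse on `K`, is continuous on `S`. -/
theorem IsCompact.continuousOn_inverse {X Y : Type*} [TopologicalSpace X] [TopologicalSpace Y]
    [T2Space Y] {K : Set X} {S : Set Y} {f : X → Y} {g : Y → X} (hK : IsCompact K)
    (hf : ContinuousOn f K) (hgf : ∀ x ∈ K, g (f x) = x)
    (hfg : ∀ y ∈ S, g y ∈ K ∧ f (g y) = y) : ContinuousOn g S := by
  refine continuousOn_iff_isClosed.2 fun t ht => ⟨f '' (K ∩ t), ?_, ?_⟩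
  · exact ((hK.inter_right ht).image_of_continuousOn (hf.mono inter_subset_left)).isClosed
  · ext y
    refine and_congr_left fun hy => ⟨fun h => ⟨g y, ⟨(hfg y hy).1, h⟩, (hfg y hy).2⟩, ?_⟩
    rintro ⟨x, ⟨hxK, hxt⟩, rfl⟩
    rwa [mem_preimage, hgf x hxK]

/-- Inverse function theorem for a one-variable map on a compact set, within sets. -/
theorem HasDerivWithinAt.inverse_of_isCompact {K S : Set ℝ} {f g : ℝ → ℝ} {f' p : ℝ}
    (hK : IsCompact K) (hf : ContinuousOn f K) (hgf : ∀ x ∈ K, g (f x) = x)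
    (hfg : ∀ y ∈ S, g y ∈ K ∧ f (g y) = y) (hp : p ∈ K) (hpS : f p ∈ S)
    (hd : HasDerivWithinAt f f' K p) (hf' : f' ≠ 0) :
    HasDerivWithinAt g f'⁻¹ S (f p) := by
  have hcont := hK.continuousOn_inverse hf hgf hfg (f p) hpS
  have hfd : HasFDerivWithinAt f
      (ContinuousLinearEquiv.unitsEquivAut ℝ (Units.mk0 f' hf') : ℝ →L[ℝ] ℝ) K (g (f p)) := by
    rw [hgf p hp]
    exact hd.hasFDerivWithinAt
  have hinv := hfd.of_local_left_inverse (hcont.tendsto_nhdsWithin fun y hy => (hfg y hy).1) hpS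
    (eventually_nhdsWithin_of_forall fun y hy => (hfg y hy).2)
  exact hinv.hasDerivWithinAt.congr_deriv (by simp)

/-- The primitive of a function continuous on `[a, b]` has the expected derivative within
`[a, b]`, end points included. -/
theorem ContinuousOn.hasDerivWithinAt_integral_Icc {a b p : ℝ} {ρ : ℝ → ℝ}
    (hρ : ContinuousOn ρ (Icc a b)) (hp : p ∈ Icc a b) :
    HasDerivWithinAt (fun y => ∫ t in a..y, ρ t) (ρ p) (Icc a b) p := by
  have : Fact (p ∈ Icc a b) := ⟨hp⟩
  refine intervalIntegral.integral_hasDerivWithinAt_right (t := Icc a b) ?_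
    (hρ.stronglyMeasurableAtFilter_nhdsWithin measurableSet_Icc p) (hρ p hp)
  exact (hρ.mono (Icc_subset_Icc_right hp.2)).intervalIntegrable_of_Icc hp.1

/-- The derivative of the inverse cdf of a continuous density on `[a, b]` at the image of a point
where the density does not vanish. -/
theorem ContinuousOn.hasDerivWithinAt_inverse_integral {a b p : ℝ} {ρ F G : ℝ → ℝ} {S : Set ℝ}
    (hρ : ContinuousOn ρ (Icc a b)) (hF : ∀ y, F y = ∫ t in a..y, ρ t)
    (hGF : ∀ y ∈ Icc a b, G (F y) = y) (hFG : ∀ u ∈ S, G u ∈ Icc a b ∧ F (G u) = u)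
    (hp : p ∈ Icc a b) (hpS : F p ∈ S) (hρp : ρ p ≠ 0) :
    HasDerivWithinAt G (ρ p)⁻¹ S (F p) := by
  have hd : ∀ y ∈ Icc a b, HasDerivWithinAt F (ρ y) (Icc a b) y := fun y hy => by
    rw [funext hF]
    exact hρ.hasDerivWithinAt_integral_Icc hy
  exact .inverse_of_isCompact isCompact_Icc (fun y hy => (hd y hy).continuousWithinAt) hGF hFG hp
    hpS (hd p hp) hρp

/-- C¹ matching condition at the junction `β` of the piecewise transport: the left branch
`T₁ = F₁⁻¹(· − α)` has left derivative `1/ρ₁(b)` at `β`, the increasing tent branch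
`T₂` has right derivative `F₂(c)/((γ−β)ρ₂(b))` at `β`, and these agree iff
`γ = β + F₂(c)ρ₁(b)/ρ₂(b)`. -/
theorem tent_transport_C1_matching
    (a b c : ℝ) (hab : a < b) (hbc : b < c)
    (ρ₁ ρ₂ : ℝ → ℝ)
    (hρ₁c : ContinuousOn ρ₁ (Icc a b)) (hρ₁pos : ∀ y ∈ Icc a b, 0 < ρ₁ y)
    (hρ₂c : ContinuousOn ρ₂ (Icc b c)) (hρ₂pos : ∀ y ∈ Ico b c, 0 < ρ₂ y)
    (F₁ F₂ : ℝ → ℝ)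
    (hF₁ : ∀ y, F₁ y = ∫ t in a..y, ρ₁ t)
    (hF₂ : ∀ y, F₂ y = ∫ t in b..y, ρ₂ t)
    (α β γ : ℝ) (hβ : β = α + F₁ b) (hγ : γ ∈ Ioo β (β + F₂ c))
    (F₁inv F₂inv : ℝ → ℝ)
    (hF₁inv₁ : ∀ y ∈ Icc a b, F₁inv (F₁ y) = y)
    (hF₁inv₂ : ∀ u ∈ Icc 0 (F₁ b), F₁inv u ∈ Icc a b ∧ F₁ (F₁inv u) = u)
    (hF₂inv₁ : ∀ y ∈ Icc b c, F₂inv (F₂ y) = y)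
    (hF₂inv₂ : ∀ u ∈ Icc 0 (F₂ c), F₂inv u ∈ Icc b c ∧ F₂ (F₂inv u) = u)
    (T₁ T₂ : ℝ → ℝ)
    (hT₁ : ∀ x, T₁ x = F₁inv (x - α))
    (hT₂ : ∀ x, T₂ x = F₂inv (F₂ c * (x - β) / (γ - β))) :
    HasDerivWithinAt T₁ (1 / ρ₁ b) (Iic β) β ∧
    HasDerivWithinAt T₂ (F₂ c / ((γ - β) * ρ₂ b)) (Ici β) β ∧
    (1 / ρ₁ b = F₂ c / ((γ - β) * ρ₂ b) ↔ γ = β + F₂ c * ρ₁ b / ρ₂ b) := by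
  have hF₁b : 0 < F₁ b := by
    rw [hF₁]
    exact intervalIntegral.intervalIntegral_pos_of_pos_on (hρ₁c.intervalIntegrable_of_Icc hab.le)
      (fun y hy => hρ₁pos y (Ioo_subset_Icc_self hy)) hab
  have hF₂b : F₂ b = 0 := by simp [hF₂]
  have hβγ : 0 < γ - β := sub_pos.2 hγ.1
  have hF₂c : 0 < F₂ c := by linarith [hγ.1, hγ.2]
  have hρ₁b : 0 < ρ₁ b := hρ₁pos b (right_mem_Icc.2 hab.le)
  have hρ₂b : 0 < ρ₂ b := hρ₂pos b (left_mem_Ico.2 hbc)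
  have hd₁ := hρ₁c.hasDerivWithinAt_inverse_integral hF₁ hF₁inv₁ hF₁inv₂
    (right_mem_Icc.2 hab.le) (right_mem_Icc.2 hF₁b.le) hρ₁b.ne'
  have hd₂ := hρ₂c.hasDerivWithinAt_inverse_integral hF₂ hF₂inv₁ hF₂inv₂
    (left_mem_Icc.2 hbc.le) ⟨hF₂b.ge, hF₂b.trans_le hF₂c.le⟩ hρ₂b.ne'
  refine ⟨?_, ?_, ?_⟩
  · rw [funext hT₁]
    have hin : HasDerivWithinAt (fun x => x - α) 1 (Icc α β) β :=
      ((hasDerivAt_id' β).sub_const α).hasDerivWithinAt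
    have hmaps : MapsTo (fun x => x - α) (Icc α β) (Icc 0 (F₁ b)) := fun x hx =>
      ⟨by linarith [hx.1], by linarith [hx.2]⟩
    have h := hd₁.scomp_of_eq β hin hmaps (by rw [hβ]; ring)
    rw [one_smul, inv_eq_one_div] at h
    exact h.mono_of_mem_nhdsWithin (Icc_mem_nhdsLE (by linarith))
  · rw [funext hT₂]
    have hin : HasDerivWithinAt (fun x => F₂ c * (x - β) / (γ - β)) (F₂ c / (γ - β))
        (Icc β γ) β := by
      simpa using ((((hasDerivAt_id' β).sub_const β).const_mul (F₂ c)).div_const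
        (γ - β)).hasDerivWithinAt
    have hmaps : MapsTo (fun x => F₂ c * (x - β) / (γ - β)) (Icc β γ) (Icc 0 (F₂ c)) := by
      intro x hx
      have hx₀ : 0 ≤ x - β := sub_nonneg.2 hx.1
      refine ⟨by positivity, (div_le_iff₀ hβγ).2 ?_⟩
      gcongr
      exact hx.2
    have h := hd₂.scomp_of_eq β hin hmaps (by simp [hF₂b])
    rw [smul_eq_mul, ← div_eq_mul_inv, div_div] at h
    exact h.mono_of_mem_nhdsWithin (Icc_mem_nhdsGE hγ.1)
  · rw [← sub_eq_iff_eq_add', div_eq_div_iff hρ₁b.ne' (by positivity), one_mul,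
      eq_div_iff hρ₂b.ne']
end

section
/- Let b < c, let ρ₂ : [b,c) → ℝ be continuous with ρ₂ > 0 on [b,c) and lim_{y→c⁻} ρ₂(y) = ∞, integrable on [b,c] with F(y) = ∫_b^y ρ₂ dλ and F(c) = lim_{y→c⁻} F(y) finite. Let β ∈ ℝ, δ = β + F(c), γ ∈ (β, δ), and define T₂(x) = F⁻¹( F(c)(x − β)/(γ − β) ) on [β, γ) and T₃(x) = F⁻¹( F(c)(x − β − F(c))/(γ − β − F(c)) ) on (γ, δ]. Then T₂ is differentiable on (β, γ) with T₂'(x) = F(c)/((γ − β) ρ₂(T₂(x))), T₃ is differentiable on (γ, δ) with |T₃'(x)| = F(c)/((δ − γ) ρ₂(T₃(x))), and lim_{x→γ⁻} T₂'(x) = 0 and lim_{x→γ⁺} T₃'(x) = 0. -/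
open MeasureTheory Set Filter

section PrimitiveInverse

variable {b c : ℝ} {ρ F G : ℝ → ℝ}

/-- The primitive of a density that is positive on `[b, c)` is strictly increasing on `[b, c]`. -/
theorem strictMonoOn_primitive_of_pos (hρpos : ∀ y ∈ Ico b c, 0 < ρ y)
    (hρint : IntegrableOn ρ (Icc b c)) (hF : ∀ y, F y = ∫ t in b..y, ρ t) :
    StrictMonoOn F (Icc b c) := by
  intro x hx y hy hxy
  have hint : ∀ {p q : ℝ}, p ∈ Icc b c → q ∈ Icc b c → IntervalIntegrable ρ volume p q :=
    fun hp hq => (hρint.mono_set (uIcc_subset_Icc hp hq)).intervalIntegrable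
  have hb : b ∈ Icc b c := ⟨le_rfl, hx.1.trans hx.2⟩
  have hpos : 0 < ∫ t in x..y, ρ t :=
    intervalIntegral.intervalIntegral_pos_of_pos_on (hint hx hy)
      (fun t ht => hρpos t ⟨hx.1.trans ht.1.le, ht.2.trans_le hy.2⟩) hxy
  have hadd := intervalIntegral.integral_add_adjacent_intervals (hint hb hx) (hint hx hy)
  rw [hF, hF]
  linarith

/-- A primitive of a density that is continuous on `[b, c)` is differentiable in `(b, c)`. -/
theorem hasDerivAt_primitive_of_continuousOn_Ico (hρc : ContinuousOn ρ (Ico b c))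
    (hρint : IntegrableOn ρ (Icc b c)) (hF : ∀ y, F y = ∫ t in b..y, ρ t)
    {y : ℝ} (hy : y ∈ Ioo b c) : HasDerivAt F (ρ y) y := by
  have hc : ContinuousOn ρ (Ioo b c) := hρc.mono Ioo_subset_Ico_self
  rw [funext hF]
  refine intervalIntegral.integral_hasDerivAt_right ?_
    (hc.stronglyMeasurableAtFilter isOpen_Ioo y hy) (hc.continuousAt (isOpen_Ioo.mem_nhds hy))
  refine (hρint.mono_set ?_).intervalIntegrable
  exact uIcc_subset_Icc ⟨le_rfl, (hy.1.trans hy.2).le⟩ ⟨hy.1.le, hy.2.le⟩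

/-- A right inverse of a strictly increasing function is strictly increasing. -/
theorem StrictMonoOn.strictMonoOn_of_rightInvOn_s12 {s t : Set ℝ} (hF : StrictMonoOn F s)
    (hG : ∀ u ∈ t, G u ∈ s ∧ F (G u) = u) : StrictMonoOn G t := by
  intro u hu v hv huv
  rw [← hF.lt_iff_lt (hG u hu).1 (hG v hv).1, (hG u hu).2, (hG v hv).2]
  exact huv

/-- An inverse of `F` on `[0, F c]` maps the open interval `(0, F c)` into `(b, c)`. -/
theorem inverse_mem_Ioo (hFb : F b = 0)
    (hG₂ : ∀ u ∈ Icc 0 (F c), G u ∈ Icc b c ∧ F (G u) = u) {u : ℝ} (hu : u ∈ Ioo 0 (F c)) :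
    G u ∈ Ioo b c := by
  obtain ⟨hm, he⟩ := hG₂ u (Ioo_subset_Icc_self hu)
  refine ⟨lt_of_le_of_ne hm.1 ?_, lt_of_le_of_ne hm.2 ?_⟩
  · intro h
    rw [← h, hFb] at he
    exact hu.1.ne he
  · intro h
    rw [h] at he
    exact hu.2.ne he.symm

/-- The inverse of a strictly increasing `F` is continuous in `(0, F c)`. -/
theorem continuousAt_inverse (hbc : b < c) (hmono : StrictMonoOn F (Icc b c))
    (hFb : F b = 0) (hG₁ : ∀ y ∈ Icc b c, G (F y) = y)
    (hG₂ : ∀ u ∈ Icc 0 (F c), G u ∈ Icc b c ∧ F (G u) = u)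
    {u : ℝ} (hu : u ∈ Ioo 0 (F c)) : ContinuousAt G u := by
  refine (hmono.strictMonoOn_of_rightInvOn_s12 hG₂).continuousAt_of_image_mem_nhds
    (Icc_mem_nhds hu.1 hu.2) ?_
  have hy := inverse_mem_Ioo hFb hG₂ hu
  refine mem_of_superset (Icc_mem_nhds hy.1 hy.2) fun y hy => ⟨F y, ⟨?_, ?_⟩, hG₁ y hy⟩
  · rw [← hFb]
    exact hmono.monotoneOn ⟨le_rfl, hbc.le⟩ hy hy.1
  · exact hmono.monotoneOn hy ⟨hbc.le, le_rfl⟩ hy.2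

/-- Inverse function rule for the inverse of a primitive of `ρ`. -/
theorem hasDerivAt_inverse (hbc : b < c) (hmono : StrictMonoOn F (Icc b c))
    (hFb : F b = 0) (hG₁ : ∀ y ∈ Icc b c, G (F y) = y)
    (hG₂ : ∀ u ∈ Icc 0 (F c), G u ∈ Icc b c ∧ F (G u) = u)
    (hρpos : ∀ y ∈ Ico b c, 0 < ρ y)
    (hderiv : ∀ y ∈ Ioo b c, HasDerivAt F (ρ y) y) {u : ℝ} (hu : u ∈ Ioo 0 (F c)) :
    HasDerivAt G (ρ (G u))⁻¹ u := by
  have hy := inverse_mem_Ioo hFb hG₂ hu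
  refine (hderiv _ hy).of_local_left_inverse (continuousAt_inverse hbc hmono hFb hG₁ hG₂ hu)
    (hρpos _ (Ioo_subset_Ico_self hy)).ne' ?_
  filter_upwards [Icc_mem_nhds hu.1 hu.2] with v hv using (hG₂ v hv).2

/-- The inverse tends to `c` from the left at the right endpoint `F c`. -/
theorem tendsto_inverse_nhdsLT (hbc : b < c) (hmono : StrictMonoOn F (Icc b c))
    (hFb : F b = 0)
    (hG₂ : ∀ u ∈ Icc 0 (F c), G u ∈ Icc b c ∧ F (G u) = u) :
    Tendsto G (nhdsWithin (F c) (Iio (F c))) (nhdsWithin c (Iio c)) := by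
  have hb : b ∈ Icc b c := ⟨le_rfl, hbc.le⟩
  have hc : c ∈ Icc b c := ⟨hbc.le, le_rfl⟩
  have hFc : 0 < F c := hFb ▸ hmono hb hc hbc
  have hlt : ∀ᶠ u in nhdsWithin (F c) (Iio (F c)), G u < c := by
    filter_upwards [Ioo_mem_nhdsLT hFc] with u hu
    exact (inverse_mem_Ioo hFb hG₂ hu).2
  refine tendsto_nhdsWithin_iff.2 ⟨tendsto_order.2 ⟨fun y hy => ?_, fun y hy => ?_⟩, hlt⟩
  · have hz : max y b ∈ Icc b c := ⟨le_max_right _ _, max_le hy.le hbc.le⟩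
    have hFz : 0 ≤ F (max y b) := hFb ▸ hmono.monotoneOn hb hz hz.1
    filter_upwards [Ioo_mem_nhdsLT (hmono hz hc (max_lt hy hbc))] with u hu
    obtain ⟨hm, he⟩ := hG₂ u ⟨hFz.trans hu.1.le, hu.2.le⟩
    refine (le_max_left y b).trans_lt ((hmono.lt_iff_lt hz hm).1 ?_)
    rw [he]
    exact hu.1
  · filter_upwards [hlt] with u hu using hu.trans hy

end PrimitiveInverse

/-- Derivative of a function composed with an affine change of variables. -/
theorem hasDerivAt_comp_affine {G T : ℝ → ℝ} {m a w g x : ℝ}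
    (hT : ∀ x, T x = G (m * (x - a) / w)) (hG : HasDerivAt G g⁻¹ (m * (x - a) / w)) :
    HasDerivAt T (m / (w * g)) x := by
  have haff : HasDerivAt (fun x => m * (x - a) / w) (m * 1 / w) x :=
    (((hasDerivAt_id x).sub_const a).const_mul m).div_const w
  rw [funext hT]
  have he : m / (w * g) = g⁻¹ * (m * 1 / w) := by
    rw [mul_one, div_mul_eq_div_div, div_eq_mul_inv (m / w), mul_comm]
  rw [he]
  exact hG.comp x haff

/-- If `deriv T` is eventually `m / (w * ρ (T x))` and `ρ (T x)` blows up, then `deriv T`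
tends to `0`. -/
theorem tendsto_deriv_zero_of_tendsto_atTop {ρ T : ℝ → ℝ} {m w : ℝ} {l : Filter ℝ}
    (hd : ∀ᶠ x in l, HasDerivAt T (m / (w * ρ (T x))) x)
    (hρ : Tendsto (fun x => ρ (T x)) l atTop) : Tendsto (deriv T) l (nhds 0) := by
  have h : Tendsto (fun x => m / w / ρ (T x)) l (nhds 0) := hρ.const_div_atTop (m / w)
  refine h.congr' ?_
  filter_upwards [hd] with x hx
  rw [hx.deriv, div_mul_eq_div_div]

/-- When the target density `ρ₂` blows up at the right endpoint `c`, both branches of the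
tent-shaped transport have derivatives given by `F(c)/((width)·ρ₂(T(x)))`, and these
derivatives tend to `0` at the fold point `γ`; i.e. the tent transport is flat (C¹) at
the fold. -/
theorem tent_transport_flat_at_fold
    (b c : ℝ) (hbc : b < c)
    (ρ₂ : ℝ → ℝ)
    (hρc : ContinuousOn ρ₂ (Ico b c))
    (hρpos : ∀ y ∈ Ico b c, 0 < ρ₂ y)
    (hρtop : Tendsto ρ₂ (nhdsWithin c (Iio c)) atTop)
    (hρint : IntegrableOn ρ₂ (Icc b c))
    (F : ℝ → ℝ) (hF : ∀ y, F y = ∫ t in b..y, ρ₂ t)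
    (β δ γ : ℝ) (hδ : δ = β + F c) (hγ : γ ∈ Ioo β δ)
    (Finv : ℝ → ℝ)
    (hFinv₁ : ∀ y ∈ Icc b c, Finv (F y) = y)
    (hFinv₂ : ∀ u ∈ Icc 0 (F c), Finv u ∈ Icc b c ∧ F (Finv u) = u)
    (T₂ T₃ : ℝ → ℝ)
    (hT₂ : ∀ x, T₂ x = Finv (F c * (x - β) / (γ - β)))
    (hT₃ : ∀ x, T₃ x = Finv (F c * (x - β - F c) / (γ - β - F c))) :
    (∀ x ∈ Ioo β γ, HasDerivAt T₂ (F c / ((γ - β) * ρ₂ (T₂ x))) x) ∧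
    (∀ x ∈ Ioo γ δ, ∃ d : ℝ, HasDerivAt T₃ d x ∧ |d| = F c / ((δ - γ) * ρ₂ (T₃ x))) ∧
    Tendsto (deriv T₂) (nhdsWithin γ (Iio γ)) (nhds 0) ∧
    Tendsto (deriv T₃) (nhdsWithin γ (Ioi γ)) (nhds 0) := by
  have hmono := strictMonoOn_primitive_of_pos hρpos hρint hF
  have hFb : F b = 0 := by rw [hF, intervalIntegral.integral_same]
  have hFc : 0 < F c := hFb ▸ hmono ⟨le_rfl, hbc.le⟩ ⟨hbc.le, le_rfl⟩ hbc
  have hT₃' : ∀ x, T₃ x = Finv (F c * (x - δ) / (γ - δ)) := fun x => by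
    rw [hT₃, hδ, sub_sub, sub_sub]
  have hInv : ∀ u ∈ Ioo 0 (F c), HasDerivAt Finv (ρ₂ (Finv u))⁻¹ u := fun u hu =>
    hasDerivAt_inverse hbc hmono hFb hFinv₁ hFinv₂ hρpos
      (fun y hy => hasDerivAt_primitive_of_continuousOn_Ico hρc hρint hF hy) hu
  have hblow : Tendsto (fun u => ρ₂ (Finv u)) (nhdsWithin (F c) (Iio (F c))) atTop :=
    hρtop.comp (tendsto_inverse_nhdsLT hbc hmono hFb hFinv₂)
  have hβγ : 0 < γ - β := sub_pos.2 hγ.1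
  have hγδ : γ - δ < 0 := sub_neg.2 hγ.2
  have hu₂ : ∀ x ∈ Ioo β γ, F c * (x - β) / (γ - β) ∈ Ioo 0 (F c) := fun x hx => by
    refine ⟨div_pos (mul_pos hFc (sub_pos.2 hx.1)) hβγ, ?_⟩
    rw [div_lt_iff₀ hβγ]
    exact mul_lt_mul_of_pos_left (sub_lt_sub_right hx.2 β) hFc
  have hu₃ : ∀ x ∈ Ioo γ δ, F c * (x - δ) / (γ - δ) ∈ Ioo 0 (F c) := fun x hx => by
    refine ⟨div_pos_of_neg_of_neg (mul_neg_of_pos_of_neg hFc (sub_neg.2 hx.2)) hγδ, ?_⟩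
    rw [div_lt_iff_of_neg hγδ]
    exact mul_lt_mul_of_pos_left (sub_lt_sub_right hx.1 δ) hFc
  have hd₂ : ∀ x ∈ Ioo β γ, HasDerivAt T₂ (F c / ((γ - β) * ρ₂ (T₂ x))) x := fun x hx =>
    hasDerivAt_comp_affine hT₂ (by rw [hT₂]; exact hInv _ (hu₂ x hx))
  have hd₃ : ∀ x ∈ Ioo γ δ, HasDerivAt T₃ (F c / ((γ - δ) * ρ₂ (T₃ x))) x := fun x hx =>
    hasDerivAt_comp_affine hT₃' (by rw [hT₃']; exact hInv _ (hu₃ x hx))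
  have hlim : ∀ a : ℝ, γ - a ≠ 0 →
      Tendsto (fun x => F c * (x - a) / (γ - a)) (nhds γ) (nhds (F c)) := fun a ha => by
    have hcont : Continuous fun x : ℝ => F c * (x - a) / (γ - a) := by fun_prop
    simpa only [mul_div_cancel_right₀ _ ha] using hcont.tendsto γ
  refine ⟨hd₂, fun x hx => ⟨_, hd₃ x hx, ?_⟩, ?_, ?_⟩
  · have hy := inverse_mem_Ioo hFb hFinv₂ (hu₃ x hx)
    rw [← hT₃'] at hy
    rw [abs_div, abs_mul, abs_of_pos hFc, abs_of_neg hγδ, neg_sub,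
      abs_of_pos (hρpos _ (Ioo_subset_Ico_self hy))]
  · have hnear : ∀ᶠ x in nhdsWithin γ (Iio γ), x ∈ Ioo β γ := Ioo_mem_nhdsLT hγ.1
    refine tendsto_deriv_zero_of_tendsto_atTop (hnear.mono hd₂) ?_
    simp only [hT₂]
    exact hblow.comp (tendsto_nhdsWithin_iff.2
      ⟨(hlim β hβγ.ne').mono_left nhdsWithin_le_nhds, hnear.mono fun x hx => (hu₂ x hx).2⟩)
  · have hnear : ∀ᶠ x in nhdsWithin γ (Ioi γ), x ∈ Ioo γ δ := Ioo_mem_nhdsGT hγ.2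
    refine tendsto_deriv_zero_of_tendsto_atTop (hnear.mono hd₃) ?_
    simp only [hT₃']
    exact hblow.comp (tendsto_nhdsWithin_iff.2
      ⟨(hlim δ hγδ.ne).mono_left nhdsWithin_le_nhds, hnear.mono fun x hx => (hu₃ x hx).2⟩)
end
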